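/- arXiv:2402.11539 — 2 statements merged into one kernel-verified Lean document; each statement's English description precedes it below -/
import Mathlib

section
/- Bridge theorem: for every N ∈ ℕ and every weight w ∈ ℕ, the K_N-subspace CZ_{N,w} of K_{N,∞} spanned by the N-th cyclotomic multiple zeta values of weight w equals the K_N-subspace CL_{N,w} spanned by the Carlitz multiple polylogarithms at N-th roots of unity of weight w. -/
noncomputable section

open scoped Classical

namespace ZHPC

variable (Fq : Type) [Field Fq] [Fintype Fq]

/-- `q`, the cardinality of the base finite field `𝔽_q`. -/
def qc : ℕ := Fintype.card Fq

/-- A fixed algebraic closure `𝔽̄_q` of `𝔽_q`. -/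
abbrev Fb := AlgebraicClosure Fq

/-- The field `𝔽̄_q((1/θ))` of formal Laurent series in `1/θ` over `𝔽̄_q`, modeled as the
field of formal Laurent series in one variable, `θ` being the inverse of that variable. -/
abbrev Kinf := LaurentSeries (Fb Fq)

/-- The embedding of the constants `𝔽̄_q → 𝔽̄_q((1/θ))`. -/
def cst : Fb Fq →+* Kinf Fq := HahnSeries.C

/-- The element `θ`. -/
def theta : Kinf Fq := HahnSeries.single (-1 : ℤ) 1

/-- `ℓ_d = ∏_{i=1}^{d} (θ - θ^{q^i})`, with `ℓ_0 = 1`. -/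
def ell (d : ℕ) : Kinf Fq := ∏ i ∈ Finset.Icc 1 d, (theta Fq - theta Fq ^ qc Fq ^ i)

/-- Arrays `(𝛆;𝔰)` of some depth `n`. -/
structure PArr (F : Type) where
  depth : ℕ
  s : Fin depth → ℕ
  eps : Fin depth → F

namespace PArr

variable {F : Type}

/-- A *positive array* for level `N`: all entries `sᵢ` are positive integers and all the
characters `εᵢ` are `N`-th roots of unity. -/
def Positive [Monoid F] (N : ℕ) (A : PArr F) : Prop := (∀ i, 0 < A.s i) ∧ ∀ i, A.eps i ^ N = 1

/-- The weight `w(𝔰) = s₁ + ⋯ + s_n`. -/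
def wt (A : PArr F) : ℕ := ∑ i, A.s i

/-- The `i`-th entry of `𝔰` (`0`-indexed), with value `0` beyond the depth. -/
def sAt (A : PArr F) (i : ℕ) : ℕ := if h : i < A.depth then A.s ⟨i, h⟩ else 0

/-- The partial sums `s₁ + ⋯ + s_i` (entries beyond the depth being `0`). -/
def psum (A : PArr F) (i : ℕ) : ℕ := ∑ j ∈ Finset.range i, A.sAt j

/-- The character `χ(𝛆) = ε₁ ⋯ ε_n`. -/
def chi [CommMonoid F] (A : PArr F) : F := ∏ i, A.eps i

end PArr

/-- The Carlitz multiple polylogarithm at roots of unity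
`Li(𝛆;𝔰) = Σ_{d₁ > ⋯ > d_n ≥ 0} ε₁^{d₁}⋯ε_n^{d_n} / (ℓ_{d₁}^{s₁}⋯ℓ_{d_n}^{s_n})`. -/
def Li (A : PArr (Fb Fq)) : Kinf Fq :=
  ∑' d : {f : Fin A.depth → ℕ // StrictAnti f},
    ∏ i, cst Fq (A.eps i ^ d.1 i) / ell Fq (d.1 i) ^ A.s i

/-- `Si_d(𝛆;𝔰)`: same summand as `Li`, over decreasing tuples with `d₁ = d`. -/
def Sid (d : ℤ) (A : PArr (Fb Fq)) : Kinf Fq :=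
  ∑' f : {f : Fin A.depth → ℕ // StrictAnti f ∧ ∀ i : Fin A.depth, i.val = 0 → (f i : ℤ) = d},
    ∏ i, cst Fq (A.eps i ^ f.1 i) / ell Fq (f.1 i) ^ A.s i

/-- `Si_{<d}(𝛆;𝔰)`: same summand as `Li`, over decreasing tuples with `d > d₁`. -/
def SidLt (d : ℤ) (A : PArr (Fb Fq)) : Kinf Fq :=
  ∑' f : {f : Fin A.depth → ℕ // StrictAnti f ∧ ∀ i : Fin A.depth, (f i : ℤ) < d},
    ∏ i, cst Fq (A.eps i ^ f.1 i) / ell Fq (f.1 i) ^ A.s i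

/-- The value at `θ` of the monic polynomial `θ^e + Σ_{j<e} c_j θ^j ∈ A = 𝔽_q[θ]`. -/
def monicVal (e : ℕ) (c : Fin e → Fq) : Kinf Fq :=
  theta Fq ^ e + ∑ j, cst Fq (algebraMap Fq (Fb Fq) (c j)) * theta Fq ^ (j : ℕ)

/-- The power sum `S_d(𝛆;𝔰)`, a sum over tuples of monic polynomials `a₁, …, a_n ∈ A₊`
with `d = deg a₁ > ⋯ > deg a_n ≥ 0`; a monic polynomial of degree `e` is encoded by its
tuple of lower coefficients `c : Fin e → Fq`. -/
def Sd (d : ℤ) (A : PArr (Fb Fq)) : Kinf Fq :=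
  ∑' e : {f : Fin A.depth → ℕ // StrictAnti f ∧ ∀ i : Fin A.depth, i.val = 0 → (f i : ℤ) = d},
    ∑ c : (∀ i, Fin (e.1 i) → Fq),
      ∏ i, cst Fq (A.eps i ^ e.1 i) / monicVal Fq (e.1 i) (c i) ^ A.s i

/-- The `N`-th cyclotomic multiple zeta value `ζ_A(𝛆;𝔰) = Σ_{d ≥ 0} S_d(𝛆;𝔰)`. -/
def zetaA (A : PArr (Fb Fq)) : Kinf Fq := ∑' d : ℕ, Sd Fq (d : ℤ) A

/-- The cyclotomic field `k_N = 𝔽_q(ζ_N) ⊆ 𝔽̄_q`. -/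
def kN (N : ℕ) : Subfield (Fb Fq) :=
  Subfield.closure (Set.range (algebraMap Fq (Fb Fq)) ∪ {x | x ^ N = 1})

/-- The field `K_N = k_N(θ)`, as a subfield of `𝔽̄_q((1/θ))`. -/
def KNf (N : ℕ) : Subfield (Kinf Fq) :=
  Subfield.closure ((cst Fq '' (kN Fq N : Set (Fb Fq))) ∪ {theta Fq})

/-- The ring `A_N = k_N[θ]`, as a subring of `𝔽̄_q((1/θ))`. -/
def AN (N : ℕ) : Subring (Kinf Fq) :=
  Subring.closure ((cst Fq '' (kN Fq N : Set (Fb Fq))) ∪ {theta Fq})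

/-- `CZ_{N,w}`: the `K_N`-span of the `N`-th cyclotomic multiple zeta values of weight `w`. -/
def CZ (N w : ℕ) : Submodule (KNf Fq N) (Kinf Fq) :=
  Submodule.span (KNf Fq N) {x | ∃ A : PArr (Fb Fq), A.Positive N ∧ A.wt = w ∧ x = zetaA Fq A}

/-- `CL_{N,w}`: the `K_N`-span of the CMPL's at `N`-th roots of unity of weight `w`. -/
def CL (N w : ℕ) : Submodule (KNf Fq N) (Kinf Fq) :=
  Submodule.span (KNf Fq N) {x | ∃ A : PArr (Fb Fq), A.Positive N ∧ A.wt = w ∧ x = Li Fq A}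

/-- The index set of pairs `(𝔰,𝛆)` with `𝔰 ∈ S_w` and `𝛆 ∈ Γ_N^{depth 𝔰}`: positive arrays
of weight `w` with `q ∤ sᵢ` for all `i`. -/
def SwIdx (N w : ℕ) : Type :=
  {A : PArr (Fb Fq) // A.Positive N ∧ 0 < A.depth ∧ A.wt = w ∧ ∀ i, ¬ qc Fq ∣ A.s i}

set_option synthInstance.maxHeartbeats 1000000

section AbsI
variable {K : Type} [Field K]

/-- partial sums -/
def sg (f : ℕ → K) : ℕ → K := fun d => ∑ j ∈ Finset.range d, f j

/-- the linear map of partial sums -/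
def sgL (K : Type) [Field K] : (ℕ → K) →ₗ[K] (ℕ → K) where
  toFun := sg
  map_add' f g := by ext d; simp [sg, Finset.sum_add_distrib]
  map_smul' c f := by ext d; simp [sg, Finset.mul_sum]

/-- words -/
inductive Wd (M : Submonoid K) (X : ℕ → K → ℕ → K) : ℕ → (ℕ → K) → Prop
  | nil : Wd M X 0 1
  | cons (s : ℕ) (e : K) (w : ℕ) (r : ℕ → K) : 0 < s → e ∈ M → Wd M X w r →
      Wd M X (s + w) (sg (X s e * r))

def VV (M : Submonoid K) (X : ℕ → K → ℕ → K) (w : ℕ) : Submodule K (ℕ → K) :=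
  Submodule.span K {f | Wd M X w f}

def BB (M : Submonoid K) (X : ℕ → K → ℕ → K) (t w : ℕ) : Submodule K (ℕ → K) :=
  Submodule.span K {f | ∃ s e w' r, 0 < s ∧ s ≤ t ∧ s + w' = w ∧ e ∈ M ∧ Wd M X w' r ∧
    f = X s e * r}

variable {M : Submonoid K} {X : ℕ → K → ℕ → K}

lemma BB_mono {t t' w : ℕ} (h : t ≤ t') : BB M X t w ≤ BB M X t' w := by
  apply Submodule.span_mono
  rintro f ⟨s, e, w', r, h1, h2, h3⟩
  exact ⟨s, e, w', r, h1, h2.trans h, h3⟩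

lemma mul_mem_of_gens {S T : Set (ℕ → K)} {U : Submodule K (ℕ → K)}
    (h : ∀ f ∈ S, ∀ g ∈ T, f * g ∈ U) {f g : ℕ → K}
    (hf : f ∈ Submodule.span K S) (hg : g ∈ Submodule.span K T) : f * g ∈ U := by
  have : Submodule.span K S * Submodule.span K T ≤ U := by
    rw [Submodule.span_mul_span, Submodule.span_le]
    rintro _ ⟨f, hf, g, hg, rfl⟩
    exact h f hf g hg
  exact this (Submodule.mul_mem_mul hf hg)

lemma sg_mem {t w : ℕ} {f : ℕ → K} (hf : f ∈ BB M X t w) : sg f ∈ VV M X w := by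
  have : BB M X t w ≤ (VV M X w).comap (sgL K) := by
    apply Submodule.span_le.2
    rintro f ⟨s, e, w', r, h1, h2, rfl, h4, h5, rfl⟩
    exact Submodule.subset_span (Wd.cons s e w' r h1 h4 h5)
  exact this hf

lemma letter_mul_mem {s : ℕ} {e : K} {w : ℕ} {r : ℕ → K} (hs : 0 < s) (he : e ∈ M)
    (hr : r ∈ VV M X w) : X s e * r ∈ BB M X s (s + w) := by
  have : VV M X w ≤ (BB M X s (s + w)).comap (LinearMap.mulLeft K (X s e)) := by
    apply Submodule.span_le.2
    intro r hr
    exact Submodule.subset_span ⟨s, e, w, r, hs, le_rfl, rfl, he, hr, rfl⟩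
  exact this hr

lemma sg_mul (f g : ℕ → K) : sg f * sg g = sg (f * sg g) + sg (g * sg f) + sg (f * g) := by
  ext d
  induction d with
  | zero => simp [sg]
  | succ d ih =>
    simp only [sg, Pi.mul_apply, Pi.add_apply, Finset.sum_range_succ] at ih ⊢
    linear_combination ih

/-- the data of a multiplicative family of letters -/
def MulFam (X : ℕ → K → ℕ → K) : Prop :=
  ∀ s t a b, X s a * X t b = X (s + t) (a * b)

lemma VV_mul (hX : MulFam X) : ∀ n a b : ℕ, a + b = n → ∀ f g, f ∈ VV M X a → g ∈ VV M X b →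
    f * g ∈ VV M X (a + b) := by
  intro n
  induction n using Nat.strong_induction_on with
  | _ n ih =>
  intro a b hab f g hf hg
  refine mul_mem_of_gens ?_ hf hg
  clear hf hg f g
  rintro f hf g hg
  have hf' := hf
  have hg' := hg
  rcases hf with _ | ⟨s, e, w, r, hs, he, hr⟩
  · rw [one_mul, zero_add]; exact Submodule.subset_span hg
  rcases hg with _ | ⟨s', e', w', r', hs', he', hr'⟩
  · rw [mul_one, add_zero]; exact Submodule.subset_span hf'
  rw [sg_mul]
  refine add_mem (add_mem ?_ ?_) ?_
  · have h1 := ih (w + (s' + w')) (by omega) w (s' + w') rfl _ _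
      (Submodule.subset_span hr) (Submodule.subset_span hg')
    have h2 := sg_mem (letter_mul_mem hs he h1)
    rw [← mul_assoc, ← add_assoc] at h2
    exact h2
  · have h1 := ih (w' + (s + w)) (by omega) w' (s + w) rfl _ _
      (Submodule.subset_span hr') (Submodule.subset_span hf')
    have h2 := sg_mem (letter_mul_mem hs' he' h1)
    rw [← mul_assoc, ← add_assoc, add_comm (s' + w')] at h2
    exact h2
  · have h1 := ih (w + w') (by omega) w w' rfl _ _
      (Submodule.subset_span hr) (Submodule.subset_span hr')
    have h2 := sg_mem (letter_mul_mem (X := X) (s := s + s') (by omega) (mul_mem he he') h1)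
    rw [← hX, mul_mul_mul_comm, add_add_add_comm] at h2
    exact h2

lemma BB_mul_VV (hX : MulFam X) {t a b : ℕ} {f g : ℕ → K} (hf : f ∈ BB M X t a)
    (hg : g ∈ VV M X b) : f * g ∈ BB M X t (a + b) := by
  refine mul_mem_of_gens ?_ hf hg
  rintro _ ⟨s, e, w', r, h1, h2, rfl, h4, h5, rfl⟩ g hg
  have := letter_mul_mem (X := X) h1 h4 (VV_mul hX _ w' b rfl _ _ (Submodule.subset_span h5)
    (Submodule.subset_span hg))
  rw [← mul_assoc, ← add_assoc] at this
  exact BB_mono h2 this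

lemma BB_mul (hX : MulFam X) {t t' a b : ℕ} {f g : ℕ → K} (hf : f ∈ BB M X t a)
    (hg : g ∈ BB M X t' b) : f * g ∈ BB M X (t + t') (a + b) := by
  refine mul_mem_of_gens ?_ hf hg
  rintro _ ⟨s, e, w', r, h1, h2, rfl, h4, h5, rfl⟩ _ ⟨s', e', u', r', h1', h2', rfl, h4', h5', rfl⟩
  have := letter_mul_mem (X := X) (s := s + s') (by omega) (mul_mem h4 h4')
    (VV_mul hX _ w' u' rfl _ _ (Submodule.subset_span h5) (Submodule.subset_span h5'))
  rw [← hX, mul_mul_mul_comm, add_add_add_comm] at this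
  exact BB_mono (by omega) this

lemma BB_twist (hX : MulFam X) {t a : ℕ} {f : ℕ → K} {e : K} (he : e ∈ M) (hf : f ∈ BB M X t a) :
    X 0 e * f ∈ BB M X t a := by
  have : BB M X t a ≤ (BB M X t a).comap (LinearMap.mulLeft K (X 0 e)) := by
    apply Submodule.span_le.2
    rintro _ ⟨s, e', w', r, h1, h2, rfl, h4, h5, rfl⟩
    refine Submodule.subset_span ⟨s, e * e', w', r, h1, h2, rfl, mul_mem he h4, h5, ?_⟩
    simp only [LinearMap.mulLeft_apply]
    rw [← mul_assoc, hX, zero_add]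
  exact this hf

/-- Triangular comparison of two families of letters. -/
theorem VV_eq (hX : MulFam X) (Y : ℕ → K → ℕ → K)
    (hY : ∀ s e, 0 < s → e ∈ M → ∃ b ∈ BB M X (s - 1) s, Y s e = X s e + b) (w : ℕ) :
    VV M Y w = VV M X w := by
  apply le_antisymm
  · apply Submodule.span_le.2
    intro f hf
    induction hf with
    | nil => exact Submodule.subset_span Wd.nil
    | cons s e w r hs he hr ih =>
      apply sg_mem (t := s)
      apply BB_mul_VV hX _ ih
      obtain ⟨b, hb, h⟩ := hY s e hs he
      rw [h]
      refine add_mem ?_ (BB_mono (by omega) hb)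
      have := letter_mul_mem (X := X) hs he (Submodule.subset_span Wd.nil)
      simpa using this
  · induction w using Nat.strong_induction_on with
    | _ w ih =>
    have key : ∀ s, BB M X s w ≤ BB M Y w w := by
      intro s
      induction s using Nat.strong_induction_on with
      | _ s ihs =>
      apply Submodule.span_le.2
      rintro _ ⟨s', e, w', r, h1, h2, rfl, h4, h5, rfl⟩
      obtain ⟨b, hb, h⟩ := hY s' e h1 h4
      have hr : r ∈ VV M X w' := Submodule.subset_span h5
      have e1 : X s' e * r = Y s' e * r - b * r := by rw [h]; ring
      rw [e1]
      refine sub_mem ?_ ?_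
      · exact BB_mono (by omega) (letter_mul_mem h1 h4 (ih w' (by omega) hr))
      · exact ihs (s' - 1) (by omega) (BB_mul_VV hX hb hr)
    apply Submodule.span_le.2
    intro f hf
    rcases hf with _ | ⟨s, e, w, r, hs, he, hr⟩
    · exact Submodule.subset_span Wd.nil
    · exact sg_mem (key s (letter_mul_mem hs he (Submodule.subset_span hr)))
end AbsI

section AbsII
set_option linter.unusedSectionVars false
set_option linter.unusedVariables false
variable (Fq : Type) [Field Fq] [Fintype Fq] {K : Type} [Field K] [Algebra Fq K] (θ : K)

lemma qc_two_le : 2 ≤ qc Fq := Fintype.one_lt_card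

lemma add_pow_q (a b : K) : (a + b) ^ qc Fq = a ^ qc Fq + b ^ qc Fq :=
  map_add (FiniteField.frobeniusAlgHom Fq K) a b

lemma sub_pow_q (a b : K) : (a - b) ^ qc Fq = a ^ qc Fq - b ^ qc Fq :=
  map_sub (FiniteField.frobeniusAlgHom Fq K) a b

lemma sum_pow_q {ι : Type} (s : Finset ι) (f : ι → K) :
    (∑ i ∈ s, f i) ^ qc Fq = ∑ i ∈ s, f i ^ qc Fq :=
  map_sum (FiniteField.frobeniusAlgHom Fq K) f s

lemma alg_pow_q (a : Fq) : (algebraMap Fq K a) ^ qc Fq = algebraMap Fq K a := by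
  rw [← map_pow, qc, FiniteField.pow_card]

lemma add_pow_qi (a b : K) (i : ℕ) : (a + b) ^ qc Fq ^ i = a ^ qc Fq ^ i + b ^ qc Fq ^ i := by
  induction i with
  | zero => simp
  | succ i ih => rw [pow_succ, pow_mul, pow_mul, pow_mul, ih, add_pow_q]

lemma sub_pow_qi (a b : K) (i : ℕ) : (a - b) ^ qc Fq ^ i = a ^ qc Fq ^ i - b ^ qc Fq ^ i := by
  induction i with
  | zero => simp
  | succ i ih => rw [pow_succ, pow_mul, pow_mul, pow_mul, ih, sub_pow_q]

lemma alg_pow_qi (a : Fq) (i : ℕ) : (algebraMap Fq K a) ^ qc Fq ^ i = algebraMap Fq K a := by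
  induction i with
  | zero => simp
  | succ i ih => rw [pow_succ, pow_mul, ih, alg_pow_q]

/-- bracket -/
def br (i : ℕ) : K := θ ^ qc Fq ^ i - θ

def lK (d : ℕ) : K := ∏ i ∈ Finset.Icc 1 d, (θ - θ ^ qc Fq ^ i)

def DD : ℕ → K
  | 0 => 1
  | i + 1 => br Fq θ (i + 1) * DD i ^ qc Fq

def XX (s : ℕ) (e : K) (d : ℕ) : K := e ^ d / lK Fq θ d ^ s

lemma XX_mulFam : MulFam (XX Fq θ) := by
  intro s t a b
  ext d
  simp only [XX, Pi.mul_apply, mul_pow, pow_add]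
  rw [div_mul_div_comm]

lemma lK_succ (d : ℕ) : lK Fq θ (d + 1) = - (lK Fq θ d * br Fq θ (d + 1)) := by
  rw [lK, Finset.prod_Icc_succ_top (by omega), ← lK, br]; ring

lemma lK_zero : lK Fq θ 0 = 1 := by simp [lK]

variable {θ} (hθ : Transcendental Fq θ)
include hθ

lemma br_ne {i : ℕ} (hi : 0 < i) : br Fq θ i ≠ 0 := by
  intro h
  have h1 : (Polynomial.aeval θ) (Polynomial.X ^ qc Fq ^ i - Polynomial.X : Polynomial Fq) = 0 := by
    simpa [br] using h
  have h2 := (transcendental_iff.1 hθ) _ h1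
  exact FiniteField.X_pow_card_sub_X_ne_zero Fq
    (Nat.one_lt_pow hi.ne' (qc_two_le Fq)) h2

lemma lK_ne (d : ℕ) : lK Fq θ d ≠ 0 := by
  induction d with
  | zero => simp [lK_zero]
  | succ d ih =>
    rw [lK_succ]
    exact neg_ne_zero.2 (mul_ne_zero ih (br_ne Fq hθ (by omega)))

lemma DD_ne (d : ℕ) : DD Fq θ d ≠ 0 := by
  induction d with
  | zero => simp [DD]
  | succ d ih => exact mul_ne_zero (br_ne Fq hθ (by omega)) (pow_ne_zero _ ih)

omit hθ in
lemma br_pow (i : ℕ) : br Fq θ (i + 1) = br Fq θ i ^ qc Fq + br Fq θ 1 := by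
  rw [br, br, br, sub_pow_q, ← pow_mul, ← pow_succ, pow_one]; ring

/-- the key telescoping identity -/
lemma sg_key (d : ℕ) : sg (XX Fq θ (qc Fq - 1) 1) (d + 1) =
    lK Fq θ (d + 1) / (lK Fq θ 1 * lK Fq θ d ^ qc Fq) := by
  have hb1 := br_ne Fq hθ (i := 1) (by omega)
  have hq := qc_two_le Fq
  induction d with
  | zero =>
    simp [sg, XX, lK_zero, div_self (lK_ne Fq hθ 1)]
  | succ d ih =>
    rw [sg, Finset.sum_range_succ, ← sg, ih]
    have hd := lK_ne Fq hθ d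
    have hb := br_ne Fq hθ (i := d + 1) (by omega)
    have hodd : (-1 : K) ^ qc Fq = -1 := by
      have := alg_pow_q Fq (K := K) (-1); simpa using this
    have e1 : ∀ y : K, y ≠ 0 → (1 : K) / y ^ (qc Fq - 1) = y / y ^ qc Fq := by
      intro y hy
      rw [div_eq_div_iff (pow_ne_zero _ hy) (pow_ne_zero _ hy), one_mul, ← pow_succ']
      congr 1; omega
    rw [XX, one_pow, e1 _ (lK_ne Fq hθ _), lK_succ _ _ (d + 1), lK_succ _ _ d, neg_pow _ (qc Fq), hodd,
      lK_succ _ _ 0, lK_zero, mul_pow, br_pow Fq (d + 1)]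
    field_simp

/-- the twisted Frobenius-shift -/
def Tq (f : ℕ → K) : ℕ → K
  | 0 => 0
  | d + 1 => f d ^ qc Fq

omit hθ in
lemma Tq_add (f g : ℕ → K) : Tq Fq (f + g) = Tq Fq f + Tq Fq g := by
  ext d; cases d <;> simp [Tq, add_pow_q]

omit hθ in
lemma Tq_smul (c : K) (f : ℕ → K) : Tq Fq (c • f) = c ^ qc Fq • Tq Fq f := by
  ext d; cases d <;> simp [Tq, mul_pow]

omit hθ in
lemma Tq_mul (f g : ℕ → K) : Tq Fq (f * g) = Tq Fq f * Tq Fq g := by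
  ext d; cases d <;> simp [Tq, mul_pow]

omit hθ in
lemma Tq_mul_sg (f g : ℕ → K) : Tq Fq (f * sg g) = Tq Fq f * sg (Tq Fq g) := by
  ext d
  cases d with
  | zero => simp [Tq]
  | succ d =>
    simp [Tq, sg, mul_pow, sum_pow_q, Finset.sum_range_succ']

lemma Tq_letter (s : ℕ) (hs : 0 < s) (e : K) (he : e ≠ 0) : Tq Fq (XX Fq θ s e) =
    (lK Fq θ 1 ^ s * (e ^ qc Fq)⁻¹) • (XX Fq θ s (e ^ qc Fq) * sg (XX Fq θ (qc Fq - 1) 1) ^ s) := by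
  ext d
  cases d with
  | zero => simp [Tq, sg, hs.ne']
  | succ d =>
    simp only [Tq, Pi.smul_apply, Pi.mul_apply, Pi.pow_apply, smul_eq_mul]
    rw [sg_key Fq hθ, XX, XX]
    have h1 := lK_ne Fq hθ 1
    have h2 := lK_ne Fq hθ d
    have h3 := lK_ne Fq hθ (d + 1)
    have h4 : e ^ qc Fq ≠ 0 := pow_ne_zero _ he
    simp only [div_pow, mul_pow]
    rw [← pow_mul e d, mul_comm d, pow_mul, ← pow_mul _ s, mul_comm s, pow_mul]
    generalize e ^ qc Fq = a at *
    generalize lK Fq θ d ^ qc Fq = b at *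
    field_simp
    rw [pow_succ]

variable {M : Submonoid K} (hM : (0 : K) ∉ M)
include hM

omit hθ hM in
lemma VV_pow {X : ℕ → K → ℕ → K} (hX : MulFam X) {f : ℕ → K} {a : ℕ} (hf : f ∈ VV M X a) (s : ℕ) :
    f ^ s ∈ VV M X (a * s) := by
  induction s with
  | zero => rw [pow_zero, mul_zero]; exact Submodule.subset_span Wd.nil
  | succ s ih => rw [pow_succ, mul_add, mul_one]; exact VV_mul hX _ _ _ rfl _ _ ih hf

omit hθ hM in
lemma letter_mem {X : ℕ → K → ℕ → K} {s : ℕ} {e : K} (hs : 0 < s) (he : e ∈ M) :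
    X s e ∈ BB M X s s := by
  simpa using letter_mul_mem (X := X) hs he (Submodule.subset_span Wd.nil)

lemma Tq_letter_mem (s : ℕ) (hs : 0 < s) (e : K) (he : e ∈ M) :
    Tq Fq (XX Fq θ s e) ∈ BB M (XX Fq θ) s (qc Fq * s) := by
  have hq := qc_two_le Fq
  rw [Tq_letter Fq hθ s hs e (fun h => hM (h ▸ he))]
  apply Submodule.smul_mem
  have h1 : sg (XX Fq θ (qc Fq - 1) 1) ∈ VV M (XX Fq θ) (qc Fq - 1) :=
    sg_mem (letter_mem (by omega) (one_mem M))
  have h2 := letter_mul_mem (X := XX Fq θ) hs (pow_mem he (qc Fq))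
    (VV_pow (XX_mulFam Fq θ) h1 s)
  convert h2 using 2
  obtain ⟨k, hk⟩ := Nat.exists_eq_add_of_le hq
  rw [hk, show 2 + k - 1 = 1 + k by omega]; ring

lemma Tq_gen_mem {w : ℕ} {r : ℕ → K} (hr : Wd M (XX Fq θ) w r) : ∀ (s : ℕ) (hs : 0 < s) (e : K)
    (he : e ∈ M), Tq Fq (XX Fq θ s e * r) ∈ BB M (XX Fq θ) s (qc Fq * (s + w)) := by
  induction hr with
  | nil => intro s hs e he; simpa using Tq_letter_mem Fq hθ hM s hs e he
  | cons s' e' w' r' hs' he' hr' ih =>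
    intro s hs e he
    rw [Tq_mul_sg, mul_add]
    exact BB_mul_VV (XX_mulFam Fq θ) (Tq_letter_mem Fq hθ hM s hs e he) (sg_mem (ih s' hs' e' he'))

lemma Tq_mem {t w : ℕ} {f : ℕ → K} (hf : f ∈ BB M (XX Fq θ) t w) :
    Tq Fq f ∈ BB M (XX Fq θ) t (qc Fq * w) := by
  induction hf using Submodule.span_induction with
  | mem f hf =>
    obtain ⟨s, e, w', r, h1, h2, rfl, h4, h5, rfl⟩ := hf
    exact BB_mono h2 (Tq_gen_mem Fq hθ hM h5 s h1 e h4)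
  | zero =>
    have : Tq Fq (0 : ℕ → K) = 0 := by
      have := qc_two_le Fq
      ext d; cases d <;> simp [Tq]; omega
    rw [this]; exact zero_mem _
  | add f g _ _ hf hg => rw [Tq_add]; exact add_mem hf hg
  | smul c f _ hf => rw [Tq_smul]; exact Submodule.smul_mem _ _ hf

def ee (θ : K) (i d : ℕ) : K := if i ≤ d then 1 / lK Fq θ (d - i) ^ qc Fq ^ i else 0

omit hθ hM in
lemma ee_zero : ee Fq θ 0 = XX Fq θ 1 1 := by ext d; simp [ee, XX]

omit hθ hM in
lemma ee_succ (i : ℕ) : ee Fq θ (i + 1) = Tq Fq (ee Fq θ i) := by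
  have := qc_two_le Fq
  ext d
  cases d with
  | zero => simp [ee, Tq]
  | succ d =>
    simp only [ee, Tq, Nat.add_le_add_iff_right, Nat.add_sub_add_right]
    split_ifs
    · rw [div_pow, one_pow, ← pow_mul, ← pow_succ]
    · rw [zero_pow (by omega)]

lemma ee_mem (i : ℕ) : ee Fq θ i ∈ BB M (XX Fq θ) 1 (qc Fq ^ i) := by
  induction i with
  | zero => rw [ee_zero]; exact letter_mem one_pos (one_mem M)
  | succ i ih => rw [ee_succ, pow_succ']; exact Tq_mem Fq hθ hM ih

/-- A family satisfying the power sum recursion is triangular. -/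
lemma rec_mem (S : ℕ → ℕ → K) (h1 : S 1 = XX Fq θ 1 1)
    (hS : ∀ n, 0 < n → S (n + 1) = ∑ i ∈ Finset.range (n + 1), if qc Fq ^ i ≤ n then
      (DD Fq θ i)⁻¹ • (ee Fq θ i * S (n + 1 - qc Fq ^ i)) else 0) (n : ℕ) :
    S (n + 1) - XX Fq θ (n + 1) 1 ∈ BB M (XX Fq θ) n (n + 1) := by
  have hq := qc_two_le Fq
  have hXX := XX_mulFam Fq θ
  induction n using Nat.strong_induction_on with
  | _ n ih =>
  have ih' : ∀ m, 0 < m → m ≤ n → S m ∈ BB M (XX Fq θ) m m := by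
    intro m hm hmn
    obtain ⟨k, rfl⟩ : ∃ k, m = k + 1 := ⟨m - 1, by omega⟩
    rw [← sub_add_cancel (S (k + 1)) (XX Fq θ (k + 1) 1)]
    exact add_mem (BB_mono (by omega) (ih k (by omega))) (letter_mem (by omega) (one_mem M))
  rcases Nat.eq_zero_or_pos n with rfl | hn
  · rw [h1, sub_self]; exact zero_mem _
  rw [hS n hn, Finset.sum_range_succ', add_sub_assoc]
  refine add_mem (sum_mem fun i _ => ?_) ?_
  · split_ifs with hi
    · apply Submodule.smul_mem
      have hqi : 2 ≤ qc Fq ^ (i + 1) := le_trans hq (Nat.le_self_pow (by omega) _)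
      have := BB_mul hXX (ee_mem Fq hθ hM (i + 1)) (ih' (n + 1 - qc Fq ^ (i + 1)) (by omega) (by omega))
      rw [show qc Fq ^ (i + 1) + (n + 1 - qc Fq ^ (i + 1)) = n + 1 by omega] at this
      exact BB_mono (by omega) this
    · exact zero_mem _
  · rw [pow_zero, if_pos (by omega), ee_zero, DD, inv_one, one_smul, Nat.add_sub_cancel]
    obtain ⟨k, rfl⟩ : ∃ k, n = k + 1 := ⟨n - 1, by omega⟩
    have h2 : XX Fq θ (k + 1 + 1) 1 = XX Fq θ 1 1 * XX Fq θ (k + 1) 1 := by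
      rw [hXX, mul_one, add_comm 1]
    rw [h2, ← mul_sub, add_comm (k + 1) 1]
    have := BB_mul hXX (letter_mem (X := XX Fq θ) one_pos (one_mem M)) (ih k (by omega))
    exact BB_mono (by omega) this
end AbsII

section AbsIII
set_option linter.unusedSectionVars false
set_option linter.unusedVariables false
variable (Fq : Type) [Field Fq] [Fintype Fq] {K : Type} [Field K] [Algebra Fq K] (θ : K)

/-- monic polynomial value -/
def mv (d : ℕ) (c : Fin d → Fq) : K := θ ^ d + ∑ j, algebraMap Fq K (c j) * θ ^ (j : ℕ)

def PS (s d : ℕ) : K := ∑ c : Fin d → Fq, 1 / mv Fq θ d c ^ s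

/-- coefficients of the Carlitz polynomial -/
def pc (d i : ℕ) : K := 1 / (DD Fq θ i * lK Fq θ (d - i) ^ qc Fq ^ i)

def psi (d : ℕ) (z : K) : K := ∑ i ∈ Finset.range (d + 1), pc Fq θ d i * z ^ qc Fq ^ i

lemma psi_add (d : ℕ) (y z : K) : psi Fq θ d (y + z) = psi Fq θ d y + psi Fq θ d z := by
  simp only [psi, add_pow_qi, mul_add, Finset.sum_add_distrib]

lemma psi_smul (d : ℕ) (a : Fq) (z : K) :
    psi Fq θ d (algebraMap Fq K a * z) = algebraMap Fq K a * psi Fq θ d z := by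
  simp only [psi, mul_pow, alg_pow_qi, Finset.mul_sum]
  exact Finset.sum_congr rfl fun i _ => by ring

lemma psi_zero (d : ℕ) : psi Fq θ d 0 = 0 := by
  have := psi_smul Fq θ d 0 0
  simpa using this

lemma psi_sum (d : ℕ) {ι : Type} (s : Finset ι) (f : ι → K) :
    psi Fq θ d (∑ i ∈ s, f i) = ∑ i ∈ s, psi Fq θ d (f i) := by
  induction s using Finset.induction_on with
  | empty => simp [psi_zero]
  | insert a s ha ih => rw [Finset.sum_insert ha, Finset.sum_insert ha, psi_add, ih]

variable {θ} (hθ : Transcendental Fq θ)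
include hθ

lemma psi_A (d : ℕ) (z : K) : br Fq θ (d + 1) * psi Fq θ (d + 1) z =
    psi Fq θ d z ^ qc Fq - psi Fq θ d z := by
  have hodd : (-1 : K) ^ qc Fq = -1 := by
    have := alg_pow_q Fq (K := K) (-1); simpa using this
  have hl := lK_ne Fq hθ
  have hD := DD_ne Fq hθ
  have hb : ∀ i, br Fq θ (i + 1) ≠ 0 := fun i => br_ne Fq hθ (by omega)
  rw [psi, psi, sum_pow_q, Finset.sum_range_succ', Finset.sum_range_succ]
  rw [Finset.sum_range_succ (n := d), Finset.sum_range_succ' (n := d)]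
  have key : ∀ i ∈ Finset.range d, br Fq θ (d + 1) * (pc Fq θ (d + 1) (i + 1) * z ^ qc Fq ^ (i + 1))
      = (pc Fq θ d i * z ^ qc Fq ^ i) ^ qc Fq - pc Fq θ d (i + 1) * z ^ qc Fq ^ (i + 1) := by
    intro i hi
    have hi := Finset.mem_range.1 hi
    obtain ⟨k, rfl⟩ : ∃ k, d = i + 1 + k := ⟨d - (i + 1), by omega⟩
    have e1 : br Fq θ (i + 1 + k + 1) = br Fq θ (k + 1) ^ qc Fq ^ (i + 1) + br Fq θ (i + 1) := by
      rw [br, br, br, sub_pow_qi, ← pow_mul, ← pow_add]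
      ring_nf
    rw [mul_pow, ← pow_mul, ← pow_succ, pc, pc, pc, e1]
    rw [show i + 1 + k + 1 - (i + 1) = k + 1 by omega, show i + 1 + k - i = k + 1 by omega,
      show i + 1 + k - (i + 1) = k by omega, lK_succ _ _ k, div_pow, mul_pow, ← pow_mul, ← pow_succ,
      DD, neg_pow, one_pow]
    have hodd' : (-1 : K) ^ qc Fq ^ (i + 1) = -1 := by
      have := alg_pow_qi Fq (K := K) (-1) (i + 1); simpa using this
    rw [hodd', mul_pow]
    have h1 := hl k
    have h2 := hD i
    have h3 := hb k
    have h4 := hb i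
    have h5 : lK Fq θ k ^ qc Fq ^ (i + 1) ≠ 0 := pow_ne_zero _ h1
    have h6 : br Fq θ (k + 1) ^ qc Fq ^ (i + 1) ≠ 0 := pow_ne_zero _ h3
    have h7 : DD Fq θ i ^ qc Fq ≠ 0 := pow_ne_zero _ h2
    generalize lK Fq θ k ^ qc Fq ^ (i + 1) = A at *
    generalize br Fq θ (k + 1) ^ qc Fq ^ (i + 1) = B at *
    generalize DD Fq θ i ^ qc Fq = C at *
    field_simp
    ring
  have k0 : br Fq θ (d + 1) * (pc Fq θ (d + 1) 0 * z ^ qc Fq ^ 0) = - (pc Fq θ d 0 * z ^ qc Fq ^ 0) := by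
    have h1 := hl d
    have h2 := hb d
    simp only [pc, DD, pow_zero, pow_one, Nat.sub_zero, lK_succ _ _ d]
    field_simp
  have k1 : br Fq θ (d + 1) * (pc Fq θ (d + 1) (d + 1) * z ^ qc Fq ^ (d + 1)) =
      (pc Fq θ d d * z ^ qc Fq ^ d) ^ qc Fq := by
    have h1 := hD d
    have h2 := hb d
    rw [mul_pow, ← pow_mul, ← pow_succ]
    simp only [pc, DD, Nat.sub_self, lK_zero, one_pow, mul_one, div_pow]
    field_simp
  rw [mul_add, mul_add, k0, k1, Finset.mul_sum, Finset.sum_congr rfl key, Finset.sum_sub_distrib]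
  ring

lemma psi_B (d : ℕ) (z : K) : psi Fq θ (d + 1) (θ * z) =
    θ * psi Fq θ (d + 1) z + psi Fq θ d z ^ qc Fq := by
  have hl := lK_ne Fq hθ
  have hD := DD_ne Fq hθ
  have hb : ∀ i, br Fq θ (i + 1) ≠ 0 := fun i => br_ne Fq hθ (by omega)
  rw [psi, psi, psi, sum_pow_q, Finset.mul_sum, Finset.sum_range_succ',
    Finset.sum_range_succ' _ (d + 1)]
  have key : ∀ i ∈ Finset.range (d + 1), pc Fq θ (d + 1) (i + 1) * (θ * z) ^ qc Fq ^ (i + 1) =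
      θ * (pc Fq θ (d + 1) (i + 1) * z ^ qc Fq ^ (i + 1)) + (pc Fq θ d i * z ^ qc Fq ^ i) ^ qc Fq := by
    intro i hi
    rw [mul_pow _ (z ^ _), ← pow_mul, ← pow_succ, pc, pc, div_pow, mul_pow, mul_pow, ← pow_mul,
      ← pow_succ, Nat.add_sub_add_right, DD, one_pow]
    have h1 := hD i
    have h2 := hb i
    have h3 := hl (d - i)
    have h4 : θ ^ qc Fq ^ (i + 1) = br Fq θ (i + 1) + θ := by rw [br]; ring
    rw [h4]
    field_simp
    ring
  rw [Finset.sum_congr rfl key, Finset.sum_add_distrib]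
  simp only [pow_zero, pow_one]
  ring

lemma psi_C (d : ℕ) : psi Fq θ d (θ ^ d) = 1 ∧ ∀ k < d, psi Fq θ d (θ ^ k) = 0 := by
  have hq := qc_two_le Fq
  induction d with
  | zero => simp [psi, pc, DD, lK_zero]
  | succ d ih =>
    obtain ⟨h1, h2⟩ := ih
    have hb := br_ne Fq hθ (i := d + 1) (by omega)
    have h3 : ∀ k < d + 1, psi Fq θ (d + 1) (θ ^ k) = 0 := by
      intro k hk
      have hA := psi_A Fq hθ d (θ ^ k)
      have : psi Fq θ d (θ ^ k) ^ qc Fq - psi Fq θ d (θ ^ k) = 0 := by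
        rcases Nat.lt_succ_iff_lt_or_eq.1 hk with h | rfl
        · rw [h2 k h, zero_pow (by omega), sub_zero]
        · rw [h1, one_pow, sub_self]
      rw [this] at hA
      exact (mul_eq_zero.1 hA).resolve_left hb
    refine ⟨?_, h3⟩
    rw [pow_succ', psi_B Fq hθ, h3 d (by omega), h1]; simp

lemma psi_mv (d : ℕ) (c : Fin d → Fq) : psi Fq θ d (mv Fq θ d c) = 1 := by
  rw [mv, psi_add, (psi_C Fq hθ d).1, psi_sum, Finset.sum_eq_zero, add_zero]
  intro j _
  rw [psi_smul, (psi_C Fq hθ d).2 j j.2, mul_zero]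

lemma mv_inj (d : ℕ) : Function.Injective (mv Fq θ d) := by
  intro c c' h
  have h1 : Polynomial.aeval θ (∑ j : Fin d, Polynomial.monomial (j : ℕ) (c j - c' j)) = 0 := by
    rw [map_sum]
    simp only [Polynomial.aeval_monomial, map_sub, Finset.sum_sub_distrib]
    rw [mv, mv] at h
    exact sub_eq_zero.2 (add_left_cancel h)
  have h2 := (transcendental_iff.1 hθ) _ h1
  ext j
  have h3 := congrArg (fun p => Polynomial.coeff p (j : ℕ)) h2
  simp only [Polynomial.finsetSum_coeff, Polynomial.coeff_monomial, Polynomial.coeff_zero,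
    Fin.val_inj] at h3
  simpa [sub_eq_zero] using h3

lemma mv_ne (d : ℕ) (c : Fin d → Fq) : mv Fq θ d c ≠ 0 := by
  intro h
  have := psi_mv Fq hθ d c
  rw [h, psi_zero] at this
  exact zero_ne_one this

/-- the Carlitz polynomial -/
def psiP (θ : K) (d : ℕ) : Polynomial K :=
  ∑ i ∈ Finset.range (d + 1), Polynomial.C (pc Fq θ d i) * Polynomial.X ^ qc Fq ^ i

lemma pc_self (d : ℕ) : DD Fq θ d * pc Fq θ d d = 1 := by
  have := DD_ne Fq hθ d
  simp [pc, lK_zero, this]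

lemma PP_eq (d : ℕ) : Polynomial.C (DD Fq θ d) * (psiP Fq θ d - 1) =
    ∏ c : Fin d → Fq, (Polynomial.X - Polynomial.C (mv Fq θ d c)) := by
  have hq := qc_two_le Fq
  have hcard : (Finset.univ : Finset (Fin d → Fq)).card = qc Fq ^ d := by
    simp [qc]
  have hpos : 0 < qc Fq ^ d := by positivity
  have e1 : Polynomial.C (DD Fq θ d) * (psiP Fq θ d - 1) = Polynomial.X ^ (qc Fq ^ d) +
      (Polynomial.C (DD Fq θ d) * (∑ i ∈ Finset.range d, Polynomial.C (pc Fq θ d i) *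
        Polynomial.X ^ qc Fq ^ i - 1)) := by
    rw [psiP, Finset.sum_range_succ]
    have : Polynomial.C (DD Fq θ d) * Polynomial.C (pc Fq θ d d) = 1 := by
      rw [← Polynomial.C_mul, pc_self Fq hθ, Polynomial.C_1]
    linear_combination (Polynomial.X ^ qc Fq ^ d) * this
  have hlow : (Polynomial.C (DD Fq θ d) * (∑ i ∈ Finset.range d, Polynomial.C (pc Fq θ d i) *
        Polynomial.X ^ qc Fq ^ i - 1)).degree < ((qc Fq ^ d : ℕ) : WithBot ℕ) := by
    rw [Polynomial.degree_C_mul (DD_ne Fq hθ d)]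
    refine lt_of_le_of_lt (Polynomial.degree_sub_le _ _) (max_lt ?_ ?_)
    · refine lt_of_le_of_lt (Polynomial.degree_sum_le _ _) ?_
      rw [Finset.sup_lt_iff (WithBot.bot_lt_coe _)]
      intro i hi
      refine lt_of_le_of_lt (Polynomial.degree_C_mul_X_pow_le _ _) ?_
      exact_mod_cast Nat.pow_lt_pow_right (by omega) (Finset.mem_range.1 hi)
    · rw [Polynomial.degree_one]
      exact_mod_cast hpos
  have hm1 : (Polynomial.C (DD Fq θ d) * (psiP Fq θ d - 1)).Monic := by
    rw [e1]; exact Polynomial.monic_X_pow_add hlow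
  have hd1 : (Polynomial.C (DD Fq θ d) * (psiP Fq θ d - 1)).degree = ((qc Fq ^ d : ℕ) : WithBot ℕ) := by
    rw [e1, Polynomial.degree_add_eq_left_of_degree_lt, Polynomial.degree_X_pow]
    rwa [Polynomial.degree_X_pow]
  have hm2 : (∏ c : Fin d → Fq, (Polynomial.X - Polynomial.C (mv Fq θ d c))).Monic :=
    Polynomial.monic_prod_of_monic _ _ fun c _ => Polynomial.monic_X_sub_C _
  have hd2 : (∏ c : Fin d → Fq, (Polynomial.X - Polynomial.C (mv Fq θ d c))).degree =
      ((qc Fq ^ d : ℕ) : WithBot ℕ) := by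
    rw [Polynomial.degree_prod]
    simp [qc]
  refine Polynomial.eq_of_degree_sub_lt_of_eval_index_eq (s := Finset.univ) (v := mv Fq θ d)
    ((mv_inj Fq hθ d).injOn) ?_ ?_
  · rw [hcard, ← hd1]
    exact Polynomial.degree_sub_lt_left (hd1.trans hd2.symm) hm1.ne_zero (by rw [hm1, hm2])
  · intro c _
    have h1 : Polynomial.eval (mv Fq θ d c) (psiP Fq θ d) = 1 := by
      rw [← psi_mv Fq hθ d c, psiP, psi, Polynomial.eval_finsetSum]
      simp
    rw [Polynomial.eval_mul, Polynomial.eval_sub, h1, Polynomial.eval_one, sub_self, mul_zero,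
      Polynomial.eval_prod]
    exact (Finset.prod_eq_zero (Finset.mem_univ c) (by simp)).symm

/-- generating series -/
def Ua (a : K) : PowerSeries K := PowerSeries.mk fun n => 1 / a ^ (n + 1)

omit hθ in
lemma Ua_mul (a : K) (ha : a ≠ 0) :
    ((Polynomial.X - Polynomial.C a : Polynomial K) : PowerSeries K) * Ua a = -1 := by
  ext n
  rw [Polynomial.coe_sub, Polynomial.coe_X, Polynomial.coe_C, sub_mul, map_sub]
  rw [PowerSeries.coeff_C_mul, Ua, PowerSeries.coeff_mk]
  cases n with
  | zero => simp [ha]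
  | succ n =>
    rw [PowerSeries.coeff_succ_X_mul, PowerSeries.coeff_mk]
    simp [PowerSeries.coeff_one]
    field_simp
    ring

omit hθ in
lemma cast_q : ((qc Fq : ℕ) : K) = 0 := by
  have h : ((qc Fq : ℕ) : Fq) = 0 := FiniteField.cast_card_eq_zero Fq
  have := congrArg (algebraMap Fq K) h
  simpa using this

lemma psi_U (d : ℕ) : ((psiP Fq θ d - 1 : Polynomial K) : PowerSeries K) *
    (∑ c : Fin d → Fq, Ua (mv Fq θ d c)) = - PowerSeries.C (1 / lK Fq θ d) := by
  have hD := DD_ne Fq hθ d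
  have h0 : Polynomial.derivative (Polynomial.C (DD Fq θ d) * (psiP Fq θ d - 1)) =
      Polynomial.C (DD Fq θ d * (1 / lK Fq θ d)) := by
    rw [Polynomial.derivative_C_mul, Polynomial.C_mul, Polynomial.derivative_sub, psiP,
      Polynomial.derivative_sum, Finset.sum_range_succ', Finset.sum_eq_zero]
    · simp [pc, DD]
    · intro i _
      rw [Polynomial.derivative_C_mul_X_pow, pow_succ, Nat.cast_mul, cast_q]
      simp
  have h1 : ((Polynomial.C (DD Fq θ d) * (psiP Fq θ d - 1) : Polynomial K) : PowerSeries K) *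
    (∑ c : Fin d → Fq, Ua (mv Fq θ d c)) =
      - ((Polynomial.derivative (Polynomial.C (DD Fq θ d) * (psiP Fq θ d - 1)) : Polynomial K) :
        PowerSeries K) := by
    rw [PP_eq Fq hθ, Polynomial.derivative_prod_finset, Finset.mul_sum]
    rw [← Polynomial.coeToPowerSeries.ringHom_apply, ← Polynomial.coeToPowerSeries.ringHom_apply,
      map_sum, ← Finset.sum_neg_distrib]
    refine Finset.sum_congr rfl fun c hc => ?_
    rw [← Finset.prod_erase_mul _ _ hc, map_mul, mul_assoc]
    rw [Polynomial.coeToPowerSeries.ringHom_apply (φ := Polynomial.X - _), Ua_mul _ (mv_ne Fq hθ d c)]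
    simp
  rw [h0, Polynomial.coe_mul, Polynomial.coe_C, Polynomial.coe_C, map_mul, mul_assoc, ← mul_neg] at h1
  have hC : (PowerSeries.C (DD Fq θ d) : PowerSeries K) ≠ 0 := by
    rw [Ne, map_eq_zero_iff _ PowerSeries.C_injective]; exact hD
  exact mul_left_cancel₀ hC h1

lemma PS_coeff (n d : ℕ) : (∑ i ∈ Finset.range (d + 1), if qc Fq ^ i ≤ n then
      pc Fq θ d i * PS Fq θ (n - qc Fq ^ i + 1) d else 0) - PS Fq θ (n + 1) d =
    if n = 0 then - (1 / lK Fq θ d) else 0 := by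
  have h := congrArg (PowerSeries.coeff n) (psi_U Fq hθ d)
  have hU : ∀ m, PowerSeries.coeff m (∑ c : Fin d → Fq, Ua (mv Fq θ d c)) = PS Fq θ (m + 1) d := by
    intro m; rw [map_sum]; simp [Ua, PS]
  rw [Polynomial.coe_sub, Polynomial.coe_one, sub_mul, one_mul, map_sub, hU, psiP,
    ← Polynomial.coeToPowerSeries.ringHom_apply, map_sum, Finset.sum_mul, map_sum, map_neg,
    PowerSeries.coeff_C] at h
  rw [show (if n = 0 then - (1 / lK Fq θ d) else 0) = -(if n = 0 then (1 / lK Fq θ d) else 0) by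
    split_ifs <;> simp, ← h]
  congr 1
  refine Finset.sum_congr rfl fun i _ => ?_
  rw [map_mul Polynomial.coeToPowerSeries.ringHom, map_pow, Polynomial.coeToPowerSeries.ringHom_apply,
    Polynomial.coeToPowerSeries.ringHom_apply, Polynomial.coe_C, Polynomial.coe_X, mul_assoc,
    PowerSeries.coeff_C_mul, PowerSeries.coeff_X_pow_mul', hU]
  split_ifs <;> simp

lemma PS_one : PS Fq θ 1 = XX Fq θ 1 1 := by
  have hq := qc_two_le Fq
  ext d
  have h := PS_coeff Fq hθ 0 d
  rw [Finset.sum_eq_zero, if_pos rfl] at h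
  · rw [XX, one_pow, pow_one]
    linear_combination -h
  · intro i _
    have : 0 < qc Fq ^ i := by positivity
    rw [if_neg (by omega)]

lemma PS_rec (n : ℕ) (hn : 0 < n) : PS Fq θ (n + 1) =
    ∑ i ∈ Finset.range (n + 1), if qc Fq ^ i ≤ n then
      (DD Fq θ i)⁻¹ • (ee Fq θ i * PS Fq θ (n + 1 - qc Fq ^ i)) else 0 := by
  have hq := qc_two_le Fq
  ext d
  have h := PS_coeff Fq hθ n d
  rw [if_neg (by omega), sub_eq_zero] at h
  rw [← h, Finset.sum_apply]
  have e1 : ∀ i, (if qc Fq ^ i ≤ n then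
      (DD Fq θ i)⁻¹ • (ee Fq θ i * PS Fq θ (n + 1 - qc Fq ^ i)) else 0) d =
      if qc Fq ^ i ≤ n ∧ i ≤ d then pc Fq θ d i * PS Fq θ (n - qc Fq ^ i + 1) d else 0 := by
    intro i
    by_cases h1 : qc Fq ^ i ≤ n
    · by_cases h2 : i ≤ d
      · rw [if_pos h1, if_pos ⟨h1, h2⟩]
        simp only [Pi.smul_apply, Pi.mul_apply, ee, if_pos h2, smul_eq_mul, pc]
        rw [show n + 1 - qc Fq ^ i = n - qc Fq ^ i + 1 by omega, ← mul_assoc]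
        congr 1
        rw [one_div, one_div, mul_inv]
      · rw [if_pos h1, if_neg (by tauto)]
        simp [ee, h2]
    · rw [if_neg h1, if_neg (by tauto)]; rfl
  rw [Finset.sum_congr rfl (fun i _ => e1 i), ← Finset.sum_filter, ← Finset.sum_filter]
  refine Finset.sum_congr ?_ fun _ _ => rfl
  ext i
  simp only [Finset.mem_filter, Finset.mem_range]
  have : i < qc Fq ^ i := Nat.lt_pow_self (by omega)
  constructor
  · rintro ⟨h1, h2⟩; exact ⟨by omega, h2, by omega⟩
  · rintro ⟨h1, h2, h3⟩; exact ⟨by omega, h2⟩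

/-- The two families of words have the same span. -/
theorem VV_PS_eq {M : Submonoid K} (hM : (0 : K) ∉ M) (w : ℕ) :
    VV M (fun s e d => e ^ d * PS Fq θ s d) w = VV M (XX Fq θ) w := by
  apply VV_eq (XX_mulFam Fq θ)
  intro s e hs he
  obtain ⟨n, rfl⟩ : ∃ n, s = n + 1 := ⟨s - 1, by omega⟩
  have h := rec_mem Fq hθ hM (PS Fq θ) (PS_one Fq hθ) (PS_rec Fq hθ) n
  refine ⟨_, BB_twist (XX_mulFam Fq θ) he h, ?_⟩
  ext d
  simp [XX]
  ring
end AbsIII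

section CombIV
variable {L : Type} [Field L]

/-- strictly decreasing tuples below `d` -/
def decr (n d : ℕ) : Finset (Fin n → ℕ) :=
  (Fintype.piFinset fun _ => Finset.range d).filter StrictAnti

lemma mem_decr {n d : ℕ} {f : Fin n → ℕ} : f ∈ decr n d ↔ StrictAnti f ∧ ∀ i, f i < d := by
  simp [decr, and_comm]

/-- truncated multiple sums -/
def HH (n : ℕ) (x : Fin n → ℕ → L) (d : ℕ) : L := ∑ f ∈ decr n d, ∏ i, x i (f i)

lemma strictAnti_cons {n : ℕ} (a : ℕ) (g : Fin n → ℕ) :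
    StrictAnti (Fin.cons a g : Fin (n + 1) → ℕ) ↔ StrictAnti g ∧ ∀ i, g i < a := by
  constructor
  · intro h
    refine ⟨fun i j hij => ?_, fun i => ?_⟩
    · simpa using h (Fin.succ_lt_succ_iff.2 hij)
    · simpa using h (Fin.succ_pos i)
  · rintro ⟨h1, h2⟩ i j
    refine Fin.cases ?_ (fun i => ?_) i <;> refine Fin.cases ?_ (fun j => ?_) j
    · simp
    · intro _; simpa using h2 j
    · intro h; exact absurd h (by simp)
    · intro h; simpa using h1 (Fin.succ_lt_succ_iff.1 h)

lemma HH_zero (x : Fin 0 → ℕ → L) (d : ℕ) : HH 0 x d = 1 := by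
  have : decr 0 d = {Fin.elim0} := by
    ext f
    simp only [mem_decr, Finset.mem_singleton]
    exact ⟨fun _ => Subsingleton.elim _ _, fun _ => ⟨fun i => i.elim0, fun i => i.elim0⟩⟩
  simp [HH, this]

lemma HH_succ {n : ℕ} (x : Fin (n + 1) → ℕ → L) (d : ℕ) :
    HH (n + 1) x d = ∑ j ∈ Finset.range d, x 0 j * HH n (fun i => x i.succ) j := by
  simp only [HH, Finset.mul_sum]
  rw [Finset.sum_sigma']
  refine Finset.sum_bij' (fun f _ => ⟨f 0, Fin.tail f⟩) (fun p _ => Fin.cons p.1 p.2) ?_ ?_ ?_ ?_ ?_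
  · intro f hf
    rw [mem_decr] at hf
    obtain ⟨h1, h2⟩ := hf
    rw [← Fin.cons_self_tail f, strictAnti_cons] at h1
    simp only [Finset.mem_sigma, Finset.mem_range, mem_decr]
    exact ⟨h2 0, h1⟩
  · rintro ⟨j, g⟩ h
    simp only [Finset.mem_sigma, Finset.mem_range, mem_decr] at h
    rw [mem_decr, strictAnti_cons]
    refine ⟨h.2, fun i => Fin.cases ?_ (fun i => ?_) i⟩
    · simpa using h.1
    · simpa using (h.2.2 i).trans h.1
  · intro f _; exact Fin.cons_self_tail f
  · rintro ⟨j, g⟩ _; simp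
  · intro f _
    rw [Fin.prod_univ_succ]
    rfl

variable [TopologicalSpace L]

lemma tsum_subtype_finset {α : Type} (P : α → Prop) (s : Finset α) (h : ∀ a, P a ↔ a ∈ s)
    (F : α → L) : ∑' a : {a // P a}, F a.1 = ∑ a ∈ s, F a := by
  rw [← Finset.tsum_subtype s F]
  exact (Equiv.subtypeEquivRight h).tsum_eq (fun a : {a // a ∈ s} => F a.1)

lemma tsum_head {n : ℕ} (x : Fin (n + 1) → ℕ → L) (d : ℕ) :
    ∑' f : {f : Fin (n + 1) → ℕ // StrictAnti f ∧ ∀ i : Fin (n + 1), i.val = 0 → (f i : ℤ) = (d : ℤ)},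
      ∏ i, x i (f.1 i) = x 0 d * HH n (fun i => x i.succ) d := by
  rw [tsum_subtype_finset _ ((decr n d).image (fun g => (Fin.cons d g : Fin (n + 1) → ℕ))) _
    (fun f => ∏ i, x i (f i))]
  · rw [Finset.sum_image, HH, Finset.mul_sum]
    · refine Finset.sum_congr rfl fun g _ => ?_
      rw [Fin.prod_univ_succ]; simp
    · intro g _ g' _ h
      exact (Fin.cons_right_injective (α := fun _ => ℕ) d) h
  · intro f
    simp only [Finset.mem_image, mem_decr]
    constructor
    · rintro ⟨h1, h2⟩
      have h0 : f 0 = d := by exact_mod_cast h2 0 rfl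
      refine ⟨Fin.tail f, ?_, ?_⟩
      · rw [← strictAnti_cons, ← h0]
        rwa [Fin.cons_self_tail]
      · rw [← h0]; exact Fin.cons_self_tail f
    · rintro ⟨g, hg, rfl⟩
      refine ⟨(strictAnti_cons _ _).2 hg, fun i hi => ?_⟩
      have : i = 0 := Fin.ext hi
      subst this; simp

lemma tendsto_HH {n : ℕ} (x : Fin n → ℕ → L)
    (hs : Summable fun f : {f : Fin n → ℕ // StrictAnti f} => ∏ i, x i (f.1 i)) :
    Filter.Tendsto (HH n x) Filter.atTop
      (nhds (∑' f : {f : Fin n → ℕ // StrictAnti f}, ∏ i, x i (f.1 i))) := by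
  have h1 := hs.hasSum
  let B : ℕ → Finset {f : Fin n → ℕ // StrictAnti f} := fun d => (decr n d).subtype StrictAnti
  have hB : Filter.Tendsto B Filter.atTop Filter.atTop := by
    apply Filter.tendsto_atTop_finset_of_monotone
    · intro d d' hd f
      simp only [B, Finset.mem_subtype, mem_decr]
      exact fun h => ⟨h.1, fun i => (h.2 i).trans_le hd⟩
    · intro f
      refine ⟨(∑ i, f.1 i) + 1, ?_⟩
      simp only [B, Finset.mem_subtype, mem_decr]
      exact ⟨f.2, fun i => Nat.lt_succ_of_le
        (Finset.single_le_sum (f := f.1) (fun _ _ => Nat.zero_le _) (Finset.mem_univ i))⟩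
  have h2 := Filter.Tendsto.comp h1 hB
  convert h2 using 1
  ext d
  simp only [Function.comp, B, HH]
  rw [Finset.sum_subtype_of_mem (f := fun f : Fin n → ℕ => ∏ i, x i (f i))]
  intro f hf
  exact (mem_decr.1 hf).1
end CombIV

section TopV
set_option linter.unusedSectionVars false
variable (Fq : Type) [Field Fq] [Fintype Fq]

open WithZero in
lemma nonarch : NonarchimedeanAddGroup (Kinf Fq) where
  is_nonarchimedean U hU := by
    obtain ⟨γ, hγ⟩ := Valued.mem_nhds_zero.1 hU
    let V : AddSubgroup (Kinf Fq) := (Valued.v.restrict).ltAddSubgroup γ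
    have hV : (V : Set (Kinf Fq)) ∈ nhds (0 : Kinf Fq) :=
      Valued.mem_nhds_zero.2 ⟨γ, fun x hx => hx⟩
    exact ⟨⟨V, V.isOpen_of_mem_nhds hV⟩, hγ⟩

open WithZero in
lemma tend_zero {α : Type} {F : α → Kinf Fq}
    (h : ∀ D : ℕ, ∀ᶠ a in Filter.cofinite, Valued.v (F a) ≤ exp (-(D : ℤ))) :
    Filter.Tendsto F Filter.cofinite (nhds 0) := by
  intro U hU
  obtain ⟨γ, hγ⟩ := Valued.mem_nhds_zero.1 hU
  have h0 : MonoidWithZeroHom.ValueGroup₀.embedding γ.1 ≠ 0 := by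
    simp
  set g := MonoidWithZeroHom.ValueGroup₀.embedding γ.1 with hg
  have h1 : g = exp (log g) := (exp_log h0).symm
  refine Filter.mem_map.2 (Filter.mem_of_superset (h ((-(log g)).toNat + 1)) fun a ha => hγ ?_)
  show Valued.v.restrict (F a) < γ.1
  rw [Valuation.restrict_lt_iff_lt_embedding, ← hg, h1]
  refine lt_of_le_of_lt ha ?_
  rw [exp_lt_exp]
  push_cast
  have := Int.self_le_toNat (-(log g))
  omega

open WithZero in
lemma v_theta : Valued.v (theta Fq) = exp (1 : ℤ) := by
  have := LaurentSeries.valuation_single_zpow (Fb Fq) (-1)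
  simpa [theta] using this

open WithZero in
lemma v_cst (e : Fb Fq) : Valued.v (cst Fq e) ≤ exp (0 : ℤ) := by
  have := (LaurentSeries.valuation_le_iff_coeff_lt_eq_zero (Fb Fq) (D := 0) (f := cst Fq e)).2
  rw [neg_zero] at this
  apply this
  intro n hn
  simp only [cst, HahnSeries.C_apply]
  exact HahnSeries.coeff_single_of_ne hn.ne

open WithZero in
lemma v_inv_ell (d : ℕ) : Valued.v (1 / ell Fq d) ≤ exp (-(d : ℤ)) := by
  have key : exp (d : ℤ) ≤ Valued.v (ell Fq d) := by
    induction d with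
    | zero => simp [ell]
    | succ d ih =>
      have h2 := qc_two_le Fq
      rw [ell, Finset.prod_Icc_succ_top (by omega), map_mul]
      push_cast
      rw [exp_add]
      refine mul_le_mul' ih ?_
      have h3 : 1 < qc Fq ^ (d + 1) := Nat.one_lt_pow (by omega) (by omega)
      have h4 : Valued.v (theta Fq) < Valued.v (theta Fq ^ qc Fq ^ (d + 1)) := by
        rw [map_pow, v_theta, ← exp_nsmul, exp_lt_exp]
        rw [nsmul_eq_mul, mul_one]
        exact_mod_cast h3
      rw [Valuation.map_sub_eq_of_lt_right _ h4, ← v_theta Fq]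
      exact h4.le
  rw [map_div₀, map_one, one_div, exp_neg]
  exact inv_anti₀ (by simp) key

open WithZero in
lemma v_letter (e : Fb Fq) (s d : ℕ) (hs : 0 < s) :
    Valued.v (cst Fq e / ell Fq d ^ s) ≤ exp (-(d : ℤ)) := by
  have h1 : cst Fq e / ell Fq d ^ s = cst Fq e * (1 / ell Fq d) ^ s := by
    rw [div_pow, one_pow, mul_one_div]
  have h3 : exp (-(d : ℤ)) ≤ (exp (0 : ℤ) : ℤᵐ⁰) := exp_le_exp.2 (by omega)
  have h2 : Valued.v ((1 / ell Fq d) ^ s) ≤ exp (-(d : ℤ)) := by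
    rw [map_pow]
    obtain ⟨k, rfl⟩ : ∃ k, s = k + 1 := ⟨s - 1, by omega⟩
    rw [pow_succ]
    calc _ ≤ 1 ^ k * exp (-(d : ℤ)) := by
          refine mul_le_mul' (pow_le_pow_left' ?_ k) (v_inv_ell Fq d)
          refine (v_inv_ell Fq d).trans ?_
          simpa using h3
      _ = _ := by simp
  rw [h1, map_mul]
  calc _ ≤ exp (0 : ℤ) * exp (-(d : ℤ)) := mul_le_mul' (v_cst Fq e) h2
    _ = _ := by simp

open WithZero in
lemma summable_Li (A : PArr (Fb Fq)) (hA : ∀ i, 0 < A.s i) :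
    Summable fun d : {f : Fin A.depth → ℕ // StrictAnti f} =>
      ∏ i, cst Fq (A.eps i ^ d.1 i) / ell Fq (d.1 i) ^ A.s i := by
  have := nonarch Fq
  refine NonarchimedeanAddGroup.summable_of_tendsto_cofinite_zero (tend_zero Fq fun D => ?_)
  rw [Filter.eventually_cofinite]
  have hfin : {f : {f : Fin A.depth → ℕ // StrictAnti f} | ∀ i, f.1 i < D}.Finite := by
    refine Set.Finite.subset (Set.Finite.preimage (Subtype.val_injective.injOn)
      (decr A.depth D).finite_toSet) fun f hf => ?_
    exact mem_decr.2 ⟨f.2, hf⟩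
  refine hfin.subset fun f hf i => ?_
  by_contra hi
  apply hf
  rw [map_prod, ← Finset.mul_prod_erase _ _ (Finset.mem_univ i)]
  calc _ ≤ exp (-(f.1 i : ℤ)) * 1 := by
        refine mul_le_mul' (v_letter Fq _ _ _ (hA i)) (Finset.prod_le_one' fun j _ => ?_)
        refine (v_letter Fq _ _ _ (hA j)).trans ?_
        rw [← exp_zero, exp_le_exp]
        omega
    _ ≤ _ := by
        rw [mul_one, exp_le_exp]
        omega

lemma tendsto_Li (A : PArr (Fb Fq)) (hA : ∀ i, 0 < A.s i) :
    Filter.Tendsto (HH A.depth fun i d => cst Fq (A.eps i ^ d) / ell Fq d ^ A.s i) Filter.atTop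
      (nhds (Li Fq A)) :=
  tendsto_HH (fun i d => cst Fq (A.eps i ^ d) / ell Fq d ^ A.s i) (summable_Li Fq A hA)

lemma Sd_eq (n : ℕ) (s : Fin (n + 1) → ℕ) (eps : Fin (n + 1) → Fb Fq) (d : ℕ) (x : Fin (n + 1) → ℕ → Kinf Fq)
    (hx : x = fun i e => ∑ c : Fin e → Fq, cst Fq (eps i ^ e) / monicVal Fq e c ^ s i) :
    Sd Fq (d : ℤ) ⟨n + 1, s, eps⟩ = x 0 d * HH n (fun i => x i.succ) d := by
  rw [← tsum_head, Sd]
  refine tsum_congr fun f => ?_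
  rw [hx, Finset.prod_univ_sum, Fintype.piFinset_univ]

lemma zeta_eq (n : ℕ) (s : Fin (n + 1) → ℕ) (eps : Fin (n + 1) → Fb Fq) (y : Kinf Fq)
    (h : Filter.Tendsto (HH (n + 1) fun i e => ∑ c : Fin e → Fq, cst Fq (eps i ^ e) / monicVal Fq e c ^ s i)
      Filter.atTop (nhds y)) : zetaA Fq ⟨n + 1, s, eps⟩ = y := by
  have := nonarch Fq
  set x : Fin (n + 1) → ℕ → Kinf Fq :=
    fun i e => ∑ c : Fin e → Fq, cst Fq (eps i ^ e) / monicVal Fq e c ^ s i with hx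
  have hS : ∀ d : ℕ, Sd Fq (d : ℤ) ⟨n + 1, s, eps⟩ = x 0 d * HH n (fun i => x i.succ) d :=
    fun d => Sd_eq Fq n s eps d x hx
  have h1 : ∀ d, HH (n + 1) x d = ∑ j ∈ Finset.range d, Sd Fq (j : ℤ) ⟨n + 1, s, eps⟩ := by
    intro d
    rw [HH_succ]
    exact Finset.sum_congr rfl fun j _ => (hS j).symm
  have h2 : Filter.Tendsto (fun j : ℕ => Sd Fq (j : ℤ) ⟨n + 1, s, eps⟩) Filter.atTop (nhds 0) := by
    have h3 := ((Filter.tendsto_add_atTop_iff_nat 1).2 h).sub h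
    rw [sub_self] at h3
    refine h3.congr fun d => ?_
    rw [h1, h1, Finset.sum_range_succ, add_sub_cancel_left]
  have h4 : Summable (fun j : ℕ => Sd Fq (j : ℤ) ⟨n + 1, s, eps⟩) := by
    refine NonarchimedeanAddGroup.summable_of_tendsto_cofinite_zero ?_
    rwa [Nat.cofinite_eq_atTop]
  have h5 := h4.hasSum.tendsto_sum_nat
  exact tendsto_nhds_unique h5 (h.congr h1)
end TopV

section BridgeV
set_option linter.unusedSectionVars false

lemma word_of_arr {K L F : Type} [Field K] [Field L] (φ : K →+* L) {M : Submonoid K}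
    {X : ℕ → K → ℕ → K} {XL : ℕ → F → ℕ → L} {P : F → Prop}
    (h1 : ∀ ε, P ε → ∃ e ∈ M, ∀ s d, φ (X s e d) = XL s ε d) :
    ∀ (n : ℕ) (s : Fin n → ℕ) (eps : Fin n → F), (∀ i, 0 < s i) → (∀ i, P (eps i)) →
      ∃ f, Wd M X (∑ i, s i) f ∧ ∀ d, φ (f d) = HH n (fun i => XL (s i) (eps i)) d := by
  intro n
  induction n with
  | zero =>
    intro s eps _ _
    refine ⟨1, by simpa using Wd.nil, fun d => ?_⟩
    rw [HH_zero]; simp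
  | succ n ih =>
    intro s eps hs he
    obtain ⟨r, hr, hr'⟩ := ih (fun i => s i.succ) (fun i => eps i.succ) (fun i => hs _) (fun i => he _)
    obtain ⟨e, heM, hX⟩ := h1 _ (he 0)
    refine ⟨sg (X (s 0) e * r), ?_, fun d => ?_⟩
    · rw [Fin.sum_univ_succ]
      exact Wd.cons _ _ _ _ (hs 0) heM hr
    · rw [HH_succ, sg, map_sum]
      refine Finset.sum_congr rfl fun j _ => ?_
      rw [Pi.mul_apply, map_mul, hX, hr']

lemma arr_of_word {K L F : Type} [Field K] [Field L] (φ : K →+* L) {M : Submonoid K}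
    {X : ℕ → K → ℕ → K} {XL : ℕ → F → ℕ → L} {P : F → Prop}
    (h2 : ∀ e ∈ M, ∃ ε, P ε ∧ ∀ s d, φ (X s e d) = XL s ε d) {w : ℕ} {f : ℕ → K}
    (hf : Wd M X w f) :
    ∃ (n : ℕ) (s : Fin n → ℕ) (eps : Fin n → F), (∀ i, 0 < s i) ∧ (∀ i, P (eps i)) ∧
      ∑ i, s i = w ∧ ∀ d, φ (f d) = HH n (fun i => XL (s i) (eps i)) d := by
  induction hf with
  | nil =>
    refine ⟨0, Fin.elim0, Fin.elim0, fun i => i.elim0, fun i => i.elim0, by simp, fun d => ?_⟩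
    rw [HH_zero]; simp
  | cons s e w r hs he _ ih =>
    obtain ⟨n, s', eps', h3, h4, h5, h6⟩ := ih
    obtain ⟨ε, hε, hX⟩ := h2 e he
    refine ⟨n + 1, Fin.cons s s', Fin.cons ε eps', fun i => ?_, fun i => ?_, ?_, fun d => ?_⟩
    · exact Fin.cases (by simpa using hs) (fun i => by simpa using h3 i) i
    · exact Fin.cases (by simpa using hε) (fun i => by simpa using h4 i) i
    · rw [Fin.sum_univ_succ]; simp [h5]
    · rw [HH_succ, sg, map_sum]
      refine Finset.sum_congr rfl fun j _ => ?_
      rw [Pi.mul_apply, map_mul, hX, h6]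
      simp

lemma lim_of_span {K L : Type} [Field K] [Field L] [TopologicalSpace L] [IsTopologicalRing L]
    [Algebra K L] {G : Set (ℕ → K)} {C : Submodule K L}
    (hG : ∀ f ∈ G, ∃ x ∈ C, Filter.Tendsto (fun d => algebraMap K L (f d)) Filter.atTop (nhds x))
    {f : ℕ → K} (hf : f ∈ Submodule.span K G) :
    ∃ x ∈ C, Filter.Tendsto (fun d => algebraMap K L (f d)) Filter.atTop (nhds x) := by
  induction hf using Submodule.span_induction with
  | mem f hf => exact hG f hf
  | zero => exact ⟨0, zero_mem _, by simpa using tendsto_const_nhds⟩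
  | add f g _ _ hf hg =>
    obtain ⟨x, hx, hx'⟩ := hf
    obtain ⟨y, hy, hy'⟩ := hg
    exact ⟨x + y, add_mem hx hy, by simpa using hx'.add hy'⟩
  | smul a f _ hf =>
    obtain ⟨x, hx, hx'⟩ := hf
    refine ⟨a • x, Submodule.smul_mem _ _ hx, ?_⟩
    rw [Algebra.smul_def]
    simpa [Algebra.smul_def] using hx'.const_mul (algebraMap K L a)

variable (Fq : Type) [Field Fq] [Fintype Fq]

lemma theta_pow_coeff (n : ℕ) (c : Fb Fq) (m : ℤ) :
    (cst Fq c * theta Fq ^ n).coeff m = if m = -(n : ℤ) then c else 0 := by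
  have h : theta Fq ^ n = HahnSeries.single (-(n : ℤ)) 1 := by
    rw [theta, HahnSeries.single_pow]; simp
  rw [h, cst, HahnSeries.C_apply, HahnSeries.single_mul_single]
  simp [HahnSeries.coeff_single]

lemma KN_const (N : ℕ) (c : Fq) : cst Fq (algebraMap Fq (Fb Fq) c) ∈ KNf Fq N :=
  Subfield.subset_closure (Or.inl ⟨_, Subfield.subset_closure (Or.inl ⟨c, rfl⟩), rfl⟩)

lemma KN_root (N : ℕ) (e : Fb Fq) (he : e ^ N = 1) : cst Fq e ∈ KNf Fq N :=
  Subfield.subset_closure (Or.inl ⟨_, Subfield.subset_closure (Or.inr he), rfl⟩)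

/-- `θ` as an element of the cyclotomic function field -/
def thK (N : ℕ) : KNf Fq N := ⟨theta Fq, Subfield.subset_closure (Or.inr rfl)⟩

/-- the structure map from constants -/
def cK (N : ℕ) : Fq →+* KNf Fq N :=
  ((cst Fq).comp (algebraMap Fq (Fb Fq))).codRestrict (KNf Fq N) (KN_const Fq N)

lemma thK_trans (N : ℕ) : letI := (cK Fq N).toAlgebra; Transcendental Fq (thK Fq N) := by
  letI := (cK Fq N).toAlgebra
  rw [transcendental_iff]
  intro p hp
  rw [Polynomial.aeval_eq_sum_range] at hp
  have h1 := congrArg (Subfield.subtype (KNf Fq N)) hp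
  rw [map_sum, map_zero] at h1
  have h2 : ∀ i, (Subfield.subtype (KNf Fq N)) (p.coeff i • thK Fq N ^ i)
      = cst Fq (algebraMap Fq (Fb Fq) (p.coeff i)) * theta Fq ^ i := by
    intro i
    rw [Algebra.smul_def, map_mul, map_pow]
    rfl
  simp only [h2] at h1
  ext i
  by_cases hi : i ≤ p.natDegree
  · have h3 := congrArg (fun z : Kinf Fq => z.coeff (-(i : ℤ))) h1
    simp only [HahnSeries.coeff_sum, theta_pow_coeff, HahnSeries.coeff_zero, neg_inj, Nat.cast_inj] at h3
    rw [Finset.sum_ite_eq, if_pos (by simp; omega)] at h3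
    simpa using h3
  · rw [Polynomial.coeff_eq_zero_of_natDegree_lt (by omega), Polynomial.coeff_zero]

/-- roots of unity in the cyclotomic function field -/
def MK (N : ℕ) : Submonoid (KNf Fq N) where
  carrier := {k | ∃ ε : Fb Fq, ε ^ N = 1 ∧ (k : Kinf Fq) = cst Fq ε}
  one_mem' := ⟨1, one_pow _, by simp⟩
  mul_mem' := by
    rintro a b ⟨x, hx, hx'⟩ ⟨y, hy, hy'⟩
    refine ⟨x * y, by rw [mul_pow, hx, hy, one_mul], ?_⟩
    rw [map_mul, ← hx', ← hy']; rfl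

lemma MK_zero (N : ℕ) (hN : 0 < N) : (0 : KNf Fq N) ∉ MK Fq N := by
  rintro ⟨ε, h1, h2⟩
  have h3 : ε = 0 := by
    apply (cst Fq).injective
    rw [map_zero, ← h2]; rfl
  rw [h3, zero_pow hN.ne'] at h1
  exact zero_ne_one h1

lemma coe_XX (N : ℕ) (s d : ℕ) (e : KNf Fq N) (ε : Fb Fq) (h : (e : Kinf Fq) = cst Fq ε) :
    letI := (cK Fq N).toAlgebra
    algebraMap (KNf Fq N) (Kinf Fq) (XX Fq (thK Fq N) s e d) = cst Fq (ε ^ d) / ell Fq d ^ s := by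
  have h1 : algebraMap (KNf Fq N) (Kinf Fq) e = cst Fq ε := h
  have h2 : algebraMap (KNf Fq N) (Kinf Fq) (thK Fq N) = theta Fq := rfl
  simp only [XX, lK, ell, map_div₀, map_pow, map_prod, map_sub, h1, h2]

lemma coe_PS (N : ℕ) (s d : ℕ) (e : KNf Fq N) (ε : Fb Fq) (h : (e : Kinf Fq) = cst Fq ε) :
    letI := (cK Fq N).toAlgebra
    algebraMap (KNf Fq N) (Kinf Fq) (e ^ d * PS Fq (thK Fq N) s d)
      = ∑ c : Fin d → Fq, cst Fq (ε ^ d) / monicVal Fq d c ^ s := by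
  letI := (cK Fq N).toAlgebra
  have h1 : algebraMap (KNf Fq N) (Kinf Fq) e = cst Fq ε := h
  have h2 : algebraMap (KNf Fq N) (Kinf Fq) (thK Fq N) = theta Fq := rfl
  have h3 : ∀ c : Fq, algebraMap (KNf Fq N) (Kinf Fq) (algebraMap Fq (KNf Fq N) c)
      = cst Fq (algebraMap Fq (Fb Fq) c) := fun c => rfl
  simp only [PS, mv, monicVal, map_mul, map_sum, map_div₀, map_pow, map_add, map_one, h1, h2, h3,
    Finset.mul_sum, mul_one_div]

theorem bridge_aux (N w : ℕ) (hN : 0 < N) (hw : 0 < w) : CZ Fq N w = CL Fq N w := by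
  letI := (cK Fq N).toAlgebra
  let φ := algebraMap (KNf Fq N) (Kinf Fq)
  let X1 : ℕ → KNf Fq N → ℕ → KNf Fq N := XX Fq (thK Fq N)
  let X2 : ℕ → KNf Fq N → ℕ → KNf Fq N := fun s e d => e ^ d * PS Fq (thK Fq N) s d
  let Y1 : ℕ → Fb Fq → ℕ → Kinf Fq := fun s ε d => cst Fq (ε ^ d) / ell Fq d ^ s
  let Y2 : ℕ → Fb Fq → ℕ → Kinf Fq :=
    fun s ε d => ∑ c : Fin d → Fq, cst Fq (ε ^ d) / monicVal Fq d c ^ s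
  have hVV : VV (MK Fq N) X2 w = VV (MK Fq N) X1 w :=
    VV_PS_eq Fq (thK_trans Fq N) (MK_zero Fq N hN) w
  have a1 : ∀ ε : Fb Fq, ε ^ N = 1 → ∃ e ∈ MK Fq N, ∀ s d, φ (X1 s e d) = Y1 s ε d :=
    fun ε hε => ⟨⟨cst Fq ε, KN_root Fq N ε hε⟩, ⟨ε, hε, rfl⟩, fun s d => coe_XX Fq N s d _ ε rfl⟩
  have a2 : ∀ ε : Fb Fq, ε ^ N = 1 → ∃ e ∈ MK Fq N, ∀ s d, φ (X2 s e d) = Y2 s ε d :=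
    fun ε hε => ⟨⟨cst Fq ε, KN_root Fq N ε hε⟩, ⟨ε, hε, rfl⟩, fun s d => coe_PS Fq N s d _ ε rfl⟩
  have b1 : ∀ e ∈ MK Fq N, ∃ ε : Fb Fq, ε ^ N = 1 ∧ ∀ s d, φ (X1 s e d) = Y1 s ε d := by
    rintro e ⟨ε, h1, h2⟩
    exact ⟨ε, h1, fun s d => coe_XX Fq N s d _ ε h2⟩
  have b2 : ∀ e ∈ MK Fq N, ∃ ε : Fb Fq, ε ^ N = 1 ∧ ∀ s d, φ (X2 s e d) = Y2 s ε d := by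
    rintro e ⟨ε, h1, h2⟩
    exact ⟨ε, h1, fun s d => coe_PS Fq N s d _ ε h2⟩
  have c1 : ∀ f ∈ VV (MK Fq N) X1 w, ∃ x ∈ CL Fq N w,
      Filter.Tendsto (fun d => φ (f d)) Filter.atTop (nhds x) := by
    intro f hf
    refine lim_of_span ?_ hf
    intro f hf
    obtain ⟨n, s, eps, h1, h2, h3, h4⟩ := arr_of_word φ (P := fun ε => ε ^ N = 1) b1 hf
    refine ⟨Li Fq ⟨n, s, eps⟩, Submodule.subset_span ⟨⟨n, s, eps⟩, ⟨h1, h2⟩, h3, rfl⟩, ?_⟩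
    exact (tendsto_Li Fq ⟨n, s, eps⟩ h1).congr fun d => (h4 d).symm
  have c2 : ∀ f ∈ VV (MK Fq N) X2 w, ∃ x ∈ CZ Fq N w,
      Filter.Tendsto (fun d => φ (f d)) Filter.atTop (nhds x) := by
    intro f hf
    refine lim_of_span ?_ hf
    intro f hf
    obtain ⟨y, _, hy⟩ := c1 f (hVV ▸ Submodule.subset_span hf)
    obtain ⟨n, s, eps, h1, h2, h3, h4⟩ := arr_of_word φ (P := fun ε => ε ^ N = 1) b2 hf
    obtain _ | n := n
    · simp at h3; omega
    · refine ⟨y, ?_, hy⟩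
      rw [← zeta_eq Fq n s eps y (hy.congr h4)]
      exact Submodule.subset_span ⟨⟨n + 1, s, eps⟩, ⟨h1, h2⟩, h3, rfl⟩
  apply le_antisymm
  · refine Submodule.span_le.2 ?_
    rintro _ ⟨⟨n, s, eps⟩, ⟨h1, h2⟩, h3, rfl⟩
    obtain ⟨f, hf, hf'⟩ := word_of_arr φ (P := fun ε => ε ^ N = 1) a2 n s eps h1 h2
    have h3' : ∑ i, s i = w := h3
    rw [h3'] at hf
    obtain ⟨y, hy, hy'⟩ := c1 f (hVV ▸ Submodule.subset_span hf)
    obtain _ | n := n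
    · simp at h3'; omega
    · rw [zeta_eq Fq n s eps y (hy'.congr hf')]
      exact hy
  · refine Submodule.span_le.2 ?_
    rintro _ ⟨⟨n, s, eps⟩, ⟨h1, h2⟩, h3, rfl⟩
    obtain ⟨f, hf, hf'⟩ := word_of_arr φ (P := fun ε => ε ^ N = 1) a1 n s eps h1 h2
    have h3' : ∑ i, s i = w := h3
    rw [h3'] at hf
    obtain ⟨y, hy, hy'⟩ := c2 f (hVV ▸ Submodule.subset_span hf)
    rw [tendsto_nhds_unique (tendsto_Li Fq ⟨n, s, eps⟩ h1) (hy'.congr hf')]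
    exact hy
end BridgeV

/-- **Bridge theorem** (Theorem `bridge`): for every `N ∈ ℕ` and weight `w ∈ ℕ`, the
`K_N`-span of the `N`-th cyclotomic multiple zeta values of weight `w` equals the
`K_N`-span of the Carlitz multiple polylogarithms at `N`-th roots of unity of weight `w`. -/
theorem bridge_CZ_eq_CL
    (Fq : Type) [Field Fq] [Fintype Fq] (N w : ℕ) (hN : 0 < N) (hw : 0 < w) :
    CZ Fq N w = CL Fq N w := by
  exact bridge_aux Fq N w hN hw

end ZHPC
end
end

section
/- Strong Brown–Deligne theorem for CMPL's: for every N ∈ ℕ and w ∈ ℕ, the set {Li(𝛆;𝔰) : 𝔰 ∈ S_w, 𝛆 ∈ Γ_N^{depth(𝔰)}} spans the K_N-vector space CL_{N,w}. -/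
noncomputable section

open scoped Classical

namespace ZHPC

variable (Fq : Type) [Field Fq] [Fintype Fq]

namespace Aux
set_option linter.unusedSectionVars false
open Filter Topology

section abs
variable {L : Type} [Field L] (b : ℕ → L)

def D (a : ℕ × L) (f : ℕ → L) : ℕ → L := fun d => ∑ j ∈ Finset.range d, a.2 ^ j * b j ^ a.1 * f j

def S : List (ℕ × L) → ℕ → L
  | [] => fun _ => 1
  | a :: V => D b a (S V)

def sh (f : ℕ → L) : ℕ → L := fun d => f (d + 1)

variable (R : Subring L) (Γ : Set L)

def Pos (w : ℕ) (V : List (ℕ × L)) : Prop :=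
  (∀ a ∈ V, 0 < a.1 ∧ a.2 ∈ Γ) ∧ (V.map Prod.fst).sum = w

def F (w : ℕ) : Submodule R (ℕ → L) := Submodule.span R (S b '' {V | Pos Γ w V})

def F' (w : ℕ) : Submodule R (ℕ → L) :=
  Submodule.span R (S b '' {V | Pos Γ w V} ∪ (fun V => sh (S b V)) '' {V | Pos Γ w V})

lemma D_add (a : ℕ × L) (f g : ℕ → L) : D b a (f + g) = D b a f + D b a g := by
  funext d; simp [D, mul_add, Finset.sum_add_distrib]

lemma D_zero (a : ℕ × L) : D b a 0 = 0 := by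
  funext d; simp [D]

lemma D_smul (a : ℕ × L) (r : R) (f : ℕ → L) : D b a (r • f) = r • D b a f := by
  funext d
  simp only [D, Pi.smul_apply, Subring.smul_def, smul_eq_mul, Finset.mul_sum]
  refine Finset.sum_congr rfl fun j _ => ?_
  ring

lemma sh_add (f g : ℕ → L) : sh (f + g) = sh f + sh g := rfl
lemma sh_smul (r : R) (f : ℕ → L) : sh (r • f) = r • sh f := rfl

lemma D_mul (a c : ℕ × L) (f g : ℕ → L) : D b a f * D b c g =
    D b a (f * D b c g) + D b c (D b a f * g) + D b (a.1 + c.1, a.2 * c.2) (f * g) := by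
  funext d
  simp only [Pi.mul_apply, Pi.add_apply, D]
  induction d with
  | zero => simp
  | succ d ih =>
    simp only [Finset.sum_range_succ, add_mul, mul_add, ih, mul_pow, pow_add]
    ring

lemma D_sh (a c : ℕ × L) (f : ℕ → L) :
    D b a (sh (D b c f)) = D b a (D b c f) + D b (a.1 + c.1, a.2 * c.2) f := by
  funext d
  simp only [Pi.add_apply, D, sh, Finset.sum_range_succ, ← Finset.sum_add_distrib]
  refine Finset.sum_congr rfl fun j _ => ?_
  rw [mul_pow, pow_add]; ring

variable {b R Γ}

lemma Pos.cons {w : ℕ} {V : List (ℕ × L)} (h : Pos Γ w V) {a : ℕ × L} (ha : 0 < a.1)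
    (ha' : a.2 ∈ Γ) : Pos Γ (a.1 + w) (a :: V) := by
  refine ⟨?_, by simp [h.2]⟩
  intro c hc
  rcases List.mem_cons.1 hc with rfl | hc
  · exact ⟨ha, ha'⟩
  · exact h.1 c hc

lemma Pos.uncons {w : ℕ} {V : List (ℕ × L)} {a : ℕ × L} (h : Pos Γ w (a :: V)) :
    (0 < a.1 ∧ a.2 ∈ Γ) ∧ ∃ v, Pos Γ v V ∧ w = a.1 + v := by
  refine ⟨h.1 a (by simp), _, ⟨fun c hc => h.1 c (by simp [hc]), rfl⟩, ?_⟩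
  rw [← h.2]; simp

lemma S_mem {w : ℕ} {V : List (ℕ × L)} (h : Pos Γ w V) : S b V ∈ F b R Γ w :=
  Submodule.subset_span ⟨V, h, rfl⟩

lemma F_le (w : ℕ) : F b R Γ w ≤ F' b R Γ w := Submodule.span_mono Set.subset_union_left

lemma sh_mem {w : ℕ} {f : ℕ → L} (h : f ∈ F b R Γ w) : sh f ∈ F' b R Γ w := by
  induction h using Submodule.span_induction with
  | mem x hx =>
    obtain ⟨V, hV, rfl⟩ := hx
    exact Submodule.subset_span (Or.inr ⟨V, hV, rfl⟩)
  | zero => exact Submodule.zero_mem _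
  | add x y _ _ hx hy => rw [sh_add]; exact Submodule.add_mem _ hx hy
  | smul r x _ hx => rw [sh_smul]; exact Submodule.smul_mem _ _ hx

lemma D_mem {w : ℕ} {f : ℕ → L} (h : f ∈ F b R Γ w) {a : ℕ × L} (ha : 0 < a.1)
    (ha' : a.2 ∈ Γ) : D b a f ∈ F b R Γ (a.1 + w) := by
  induction h using Submodule.span_induction with
  | mem x hx =>
    obtain ⟨V, hV, rfl⟩ := hx
    exact S_mem (V := a :: V) (hV.cons ha ha')
  | zero => rw [D_zero]; exact Submodule.zero_mem _
  | add x y _ _ hx hy => rw [D_add]; exact Submodule.add_mem _ hx hy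
  | smul r x _ hx => rw [D_smul]; exact Submodule.smul_mem _ _ hx

lemma D_mem' (hΓ : ∀ x ∈ Γ, ∀ y ∈ Γ, x * y ∈ Γ) {w : ℕ} {f : ℕ → L}
    (h : f ∈ F' b R Γ w) {a : ℕ × L} (ha : 0 < a.1)
    (ha' : a.2 ∈ Γ) : D b a f ∈ F b R Γ (a.1 + w) := by
  induction h using Submodule.span_induction with
  | mem x hx =>
    rcases hx with hx | hx
    · obtain ⟨V, hV, rfl⟩ := hx
      exact S_mem (V := a :: V) (hV.cons ha ha')
    · obtain ⟨V, hV, rfl⟩ := hx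
      cases V with
      | nil => exact S_mem (V := [a]) (hV.cons ha ha')
      | cons c V =>
        have h1 := S_mem (b := b) (R := R) (V := a :: c :: V) (hV.cons ha ha')
        obtain ⟨hc, v, hv, rfl⟩ := hV.uncons
        have h2 := S_mem (b := b) (R := R) (hv.cons (a := (a.1 + c.1, a.2 * c.2)) (Nat.add_pos_left ha _)
          (hΓ _ ha' _ hc.2))
        simp only [S, add_assoc] at h1 h2 ⊢
        rw [D_sh]
        exact Submodule.add_mem _ h1 h2
  | zero => rw [D_zero]; exact Submodule.zero_mem _
  | add x y _ _ hx hy => rw [D_add]; exact Submodule.add_mem _ hx hy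
  | smul r x _ hx => rw [D_smul]; exact Submodule.smul_mem _ _ hx

lemma S_mul_mem (hΓ : ∀ x ∈ Γ, ∀ y ∈ Γ, x * y ∈ Γ) (V : List (ℕ × L)) :
    ∀ (W : List (ℕ × L)) (v w : ℕ), Pos Γ v V → Pos Γ w W → S b V * S b W ∈ F b R Γ (v + w) := by
  induction V with
  | nil =>
    intro W v w hV hW
    have : v = 0 := by rw [← hV.2]; simp
    subst this
    have : S b [] * S b W = S b W := by funext d; simp [S]
    rw [this, zero_add]; exact S_mem hW
  | cons a V ihV =>
    intro W
    induction W with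
    | nil =>
      intro v w hV hW
      have : w = 0 := by rw [← hW.2]; simp
      subst this
      have : S b (a :: V) * S b [] = S b (a :: V) := by funext d; simp [S]
      rw [this, add_zero]; exact S_mem hV
    | cons c W ihW =>
      intro v w hV hW
      obtain ⟨ha, v', hv', rfl⟩ := id hV.uncons
      obtain ⟨hc, w', hw', rfl⟩ := id hW.uncons
      have h1 := D_mem (ihV _ _ _ hv' hW) ha.1 ha.2
      have h2 := D_mem (ihW _ _ hV hw') hc.1 hc.2
      have h3 := D_mem (ihV _ _ _ hv' hw') (a := (a.1 + c.1, a.2 * c.2))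
        (Nat.add_pos_left ha.1 _) (hΓ _ ha.2 _ hc.2)
      have e : S b (a :: V) * S b (c :: W) = _ := D_mul b a c (S b V) (S b W)
      rw [e]
      refine Submodule.add_mem _ (Submodule.add_mem _ ?_ ?_) ?_
      · rw [show a.1 + v' + (c.1 + w') = a.1 + (v' + (c.1 + w')) by ring]; exact h1
      · rw [show a.1 + v' + (c.1 + w') = c.1 + (a.1 + v' + w') by ring]; exact h2
      · rw [show a.1 + v' + (c.1 + w') = a.1 + c.1 + (v' + w') by ring]; exact h3

lemma mul_mem_F (hΓ : ∀ x ∈ Γ, ∀ y ∈ Γ, x * y ∈ Γ) {v w : ℕ} {f g : ℕ → L}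
    (hf : f ∈ F b R Γ v) (hg : g ∈ F b R Γ w) : f * g ∈ F b R Γ (v + w) := by
  induction hf using Submodule.span_induction with
  | mem x hx =>
    obtain ⟨V, hV, rfl⟩ := hx
    induction hg using Submodule.span_induction with
    | mem y hy =>
      obtain ⟨W, hW, rfl⟩ := hy
      exact S_mul_mem hΓ _ _ _ _ hV hW
    | zero => rw [mul_zero]; exact Submodule.zero_mem _
    | add x y _ _ hx hy => rw [mul_add]; exact Submodule.add_mem _ hx hy
    | smul r x _ hx => rw [mul_smul_comm]; exact Submodule.smul_mem _ _ hx
  | zero => rw [zero_mul]; exact Submodule.zero_mem _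
  | add x y _ _ hx hy => rw [add_mul]; exact Submodule.add_mem _ hx hy
  | smul r x _ hx => rw [smul_mul_assoc]; exact Submodule.smul_mem _ _ hx

lemma pow_mem_F (hΓ : ∀ x ∈ Γ, ∀ y ∈ Γ, x * y ∈ Γ) {v : ℕ} {f : ℕ → L}
    (hf : f ∈ F b R Γ v) (k : ℕ) : f ^ k ∈ F b R Γ (k * v) := by
  induction k with
  | zero =>
    rw [pow_zero, zero_mul]
    exact S_mem (V := []) ⟨by simp, by simp⟩
  | succ k ih =>
    rw [pow_succ, add_mul, one_mul]
    exact mul_mem_F hΓ ih hf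

/-- the basic relation -/
lemma base (hΓ : ∀ x ∈ Γ, ∀ y ∈ Γ, x * y ∈ Γ) (h1Γ : (1 : L) ∈ Γ)
    (hΓi : ∀ x ∈ Γ, x ≠ 0 ∧ x⁻¹ ∈ R) {l : R} {q : ℕ} (hq : 2 ≤ q)
    (hb : ∀ d, b d ^ q = l * b (d + 1) * ∑ j ∈ Finset.range (d + 1), b j ^ (q - 1))
    {v k : ℕ} (hk : 0 < k) {e : L} (he : e ∈ Γ) {f : ℕ → L} (hf : f ∈ F b R Γ v) :
    ∃ g ∈ F' b R Γ (k * q + v), D b (k * q, e) (sh f) = l • g := by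
  set H : ℕ → L := S b [(q - 1, 1)] with hH
  have hHm : H ∈ F b R Γ (q - 1) := S_mem ⟨by simp [h1Γ]; omega, by simp⟩
  have hHd : ∀ d, H d = ∑ j ∈ Finset.range d, b j ^ (q - 1) := by
    intro d; simp [hH, S, D]
  have hg := D_mem (mul_mem_F hΓ (pow_mem_F hΓ hHm k) hf) (a := (k, e)) hk he
  have hw : k + (k * (q - 1) + v) = k * q + v := by
    obtain ⟨q, rfl⟩ : ∃ m, q = m + 1 := ⟨q - 1, by omega⟩
    simp; ring
  simp only [hw] at hg
  obtain ⟨k, rfl⟩ : ∃ m, k = m + 1 := ⟨k - 1, by omega⟩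
  refine ⟨(l ^ k * ⟨e⁻¹, (hΓi e he).2⟩ : R) • sh (D b (k + 1, e) (H ^ (k + 1) * f)),
    Submodule.smul_mem _ _ (sh_mem hg), ?_⟩
  funext d
  simp only [D, sh, Pi.smul_apply, Subring.smul_def, smul_eq_mul, Pi.mul_apply, Pi.pow_apply]
  rw [Finset.sum_range_succ']
  have h0 : H 0 = 0 := by simp [hHd]
  rw [h0]
  simp only [Finset.mul_sum, zero_pow (Nat.succ_ne_zero k), zero_mul, mul_zero, add_zero]
  refine Finset.sum_congr rfl fun j _ => ?_
  rw [mul_comm (k + 1) q, pow_mul, hb, ← hHd]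
  have := (hΓi e he).1
  push_cast
  rw [mul_pow, mul_pow, pow_succ e j, pow_succ (l : L) k]
  field_simp

lemma foldr_mem (hΓ : ∀ x ∈ Γ, ∀ y ∈ Γ, x * y ∈ Γ) {l : R} (P : List (ℕ × L)) {p v : ℕ}
    (hP : Pos Γ p P) {f : ℕ → L} (hf : ∃ g ∈ F' b R Γ v, f = l • g) :
    ∃ g ∈ F' b R Γ (p + v), P.foldr (D b) f = l • g := by
  induction P generalizing p with
  | nil =>
    have : p = 0 := by rw [← hP.2]; simp
    subst this
    simpa using hf
  | cons a P ih =>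
    obtain ⟨ha, v', hv', rfl⟩ := hP.uncons
    obtain ⟨g, hg, e⟩ := ih hv'
    refine ⟨D b a g, ?_, ?_⟩
    · rw [add_assoc]; exact F_le _ (D_mem' hΓ hg ha.1 ha.2)
    · rw [List.foldr_cons, e, D_smul]

lemma S_append (P V : List (ℕ × L)) : S b (P ++ V) = P.foldr (D b) (S b V) := by
  induction P with
  | nil => rfl
  | cons a P ih => simp [S, ih]

lemma foldr_add (P : List (ℕ × L)) (f g : ℕ → L) :
    P.foldr (D b) (f + g) = P.foldr (D b) f + P.foldr (D b) g := by
  induction P with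
  | nil => rfl
  | cons a P ih => simp [ih, D_add]

variable [TopologicalSpace L] [IsTopologicalRing L] [T2Space L]
variable {Λ : List (ℕ × L) → L}

lemma lim_mem (hΛ : ∀ w V, Pos Γ w V → Tendsto (S b V) atTop (𝓝 (Λ V))) {w : ℕ} {f : ℕ → L}
    (hf : f ∈ F' b R Γ w) :
    ∃ x ∈ Submodule.span R (Λ '' {V | Pos Γ w V}), Tendsto f atTop (𝓝 x) := by
  induction hf using Submodule.span_induction with
  | mem x hx =>
    rcases hx with hx | hx
    · obtain ⟨V, hV, rfl⟩ := hx
      exact ⟨Λ V, Submodule.subset_span ⟨V, hV, rfl⟩, hΛ _ _ hV⟩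
    · obtain ⟨V, hV, rfl⟩ := hx
      exact ⟨Λ V, Submodule.subset_span ⟨V, hV, rfl⟩,
        (hΛ _ _ hV).comp (tendsto_add_atTop_nat 1)⟩
  | zero => exact ⟨0, Submodule.zero_mem _, tendsto_const_nhds⟩
  | add x y _ _ hx hy =>
    obtain ⟨x', hx', hx⟩ := hx
    obtain ⟨y', hy', hy⟩ := hy
    exact ⟨x' + y', Submodule.add_mem _ hx' hy', hx.add hy⟩
  | smul r x _ hx =>
    obtain ⟨x', hx', hx⟩ := hx
    refine ⟨r • x', Submodule.smul_mem _ _ hx', ?_⟩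
    simp only [Subring.smul_def, smul_eq_mul]
    exact hx.const_mul _

lemma reduce (hΓ : ∀ x ∈ Γ, ∀ y ∈ Γ, x * y ∈ Γ) (h1Γ : (1 : L) ∈ Γ)
    (hΓi : ∀ x ∈ Γ, x ≠ 0 ∧ x⁻¹ ∈ R) {l : R} {q : ℕ} (hq : 2 ≤ q)
    (hb : ∀ d, b d ^ q = l * b (d + 1) * ∑ j ∈ Finset.range (d + 1), b j ^ (q - 1))
    (hΛ : ∀ w V, Pos Γ w V → Tendsto (S b V) atTop (𝓝 (Λ V))) (w : ℕ) (n : ℕ) :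
    ∀ V : List (ℕ × L), V.length ≤ n → Pos Γ w V →
      ∃ x ∈ Submodule.span R (Λ '' {V | Pos Γ w V ∧ ∀ a ∈ V, ¬ q ∣ a.1}),
      ∃ y ∈ Submodule.span R (Λ '' {V | Pos Γ w V}), Λ V = x + l • y := by
  induction n with
  | zero =>
    intro V hV hp
    have : V = [] := by simpa using hV
    subst this
    exact ⟨Λ [], Submodule.subset_span ⟨[], ⟨hp, by simp⟩, rfl⟩, 0, Submodule.zero_mem _, by simp⟩
  | succ n ih =>
    intro V hV hp
    by_cases hgood : ∀ a ∈ V, ¬ q ∣ a.1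
    · exact ⟨Λ V, Submodule.subset_span ⟨V, ⟨hp, hgood⟩, rfl⟩, 0, Submodule.zero_mem _, by simp⟩
    push Not at hgood
    obtain ⟨⟨s, e⟩, haV, k, hk⟩ := hgood
    obtain ⟨P, W, rfl⟩ := List.append_of_mem haV
    simp only at hk
    rw [mul_comm] at hk
    subst hk
    have ha := hp.1 _ haV
    have hk0 : 0 < k := Nat.pos_of_mul_pos_right ha.1
    have hPp : Pos Γ _ P := ⟨fun c hc => hp.1 c (by simp [hc]), rfl⟩
    have hWp : Pos Γ _ W := ⟨fun c hc => hp.1 c (by simp [hc]), rfl⟩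
    obtain ⟨g, hg, hge⟩ := foldr_mem hΓ P hPp
      (base hΓ h1Γ hΓi hq hb hk0 ha.2 (S_mem (b := b) (R := R) hWp))
    have hw : (P.map Prod.fst).sum + (k * q + (W.map Prod.fst).sum) = w := by
      rw [← hp.2]; simp
    rw [hw] at hg
    obtain ⟨y, hy, hyt⟩ := lim_mem hΛ hg
    have hly : Tendsto (l • g) atTop (𝓝 (l • y)) := by
      simp only [Subring.smul_def, smul_eq_mul]
      exact hyt.const_mul _
    cases W with
    | nil =>
      refine ⟨0, Submodule.zero_mem _, y, hy, ?_⟩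
      rw [zero_add]
      refine tendsto_nhds_unique (hΛ _ _ hp) ?_
      rw [S_append]
      have : sh (S b []) = S b [] := rfl
      rw [this] at hge
      simp only [S]
      simp only [S] at hge
      rw [hge]; exact hly
    | cons c W =>
      have hc := hWp.1 c (by simp)
      have hp' : Pos Γ w (P ++ (k * q + c.1, e * c.2) :: W) := by
        refine ⟨?_, ?_⟩
        · intro d hd
          rcases List.mem_append.1 hd with hd | hd
          · exact hPp.1 d hd
          rcases List.mem_cons.1 hd with rfl | hd
          · exact ⟨Nat.add_pos_left ha.1 _, hΓ _ ha.2 _ hc.2⟩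
          · exact hWp.1 d (by simp [hd])
        · rw [← hp.2]; simp; ring
      obtain ⟨x, hx, y', hy', hxy⟩ := ih _ (by simp at hV ⊢; omega) hp'
      refine ⟨-x, Submodule.neg_mem _ hx, y - y', Submodule.sub_mem _ hy hy', ?_⟩
      have key : Λ (P ++ (k * q, e) :: c :: W) + Λ (P ++ (k * q + c.1, e * c.2) :: W) = l • y := by
        refine tendsto_nhds_unique ((hΛ _ _ hp).add (hΛ _ _ hp')) ?_
        have : (fun x => S b (P ++ (k * q, e) :: c :: W) x
            + S b (P ++ (k * q + c.1, e * c.2) :: W) x) = l • g := by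
          rw [← hge]
          simp only [S]
          rw [D_sh, foldr_add]
          simp only [S_append]
          rfl
        rw [this]; exact hly
      rw [eq_sub_of_add_eq key, hxy, smul_sub]; abel

lemma finite_pos (hfin : Γ.Finite) (w : ℕ) : {V | Pos Γ w V}.Finite := by
  have hA : (Set.Iic w ×ˢ Γ).Finite := (Set.finite_Iic w).prod hfin
  have : Finite (Set.Iic w ×ˢ Γ : Set (ℕ × L)) := hA
  refine ((List.finite_length_le (Set.Iic w ×ˢ Γ : Set (ℕ × L)) w).image
    (List.map Subtype.val)).subset ?_
  rintro V ⟨h1, h2⟩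
  have h3 : ∀ a ∈ V, a.1 ≤ w := fun a ha => by
    rw [← h2]; exact List.le_sum_of_mem (List.mem_map_of_mem ha)
  have h4 : V.length ≤ w := by
    have := List.length_le_sum_of_one_le (V.map Prod.fst) (by
      intro i hi
      obtain ⟨a, ha, rfl⟩ := List.mem_map.1 hi
      exact (h1 a ha).1)
    rw [← h2]; simpa using this
  refine ⟨V.attach.map (fun a => ⟨a.1, Set.mk_mem_prod (Set.mem_Iic.2 (h3 a.1 a.2)) (h1 a.1 a.2).2⟩),
    by simpa using h4, ?_⟩
  rw [List.map_map]; exact List.attach_map_subtype_val V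

theorem main_abs (hΓ : ∀ x ∈ Γ, ∀ y ∈ Γ, x * y ∈ Γ) (h1Γ : (1 : L) ∈ Γ)
    (hΓi : ∀ x ∈ Γ, x ≠ 0 ∧ x⁻¹ ∈ R) {l : R} {q : ℕ} (hq : 2 ≤ q)
    (hb : ∀ d, b d ^ q = l * b (d + 1) * ∑ j ∈ Finset.range (d + 1), b j ^ (q - 1))
    (hΛ : ∀ w V, Pos Γ w V → Tendsto (S b V) atTop (𝓝 (Λ V))) (hfin : Γ.Finite)
    (hl : ¬ IsUnit l) (w : ℕ) :
    ∃ r : R, r ≠ 0 ∧ ∀ V, Pos Γ w V →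
      r • Λ V ∈ Submodule.span R (Λ '' {V | Pos Γ w V ∧ ∀ a ∈ V, ¬ q ∣ a.1}) := by
  set G := Submodule.span R (Λ '' {V | Pos Γ w V ∧ ∀ a ∈ V, ¬ q ∣ a.1}) with hG
  set M := Submodule.span R (Λ '' {V | Pos Γ w V}) with hM
  have hfg : (M.map G.mkQ).FG :=
    Submodule.FG.map _ (Submodule.fg_span ((finite_pos hfin w).image _))
  obtain ⟨r, hr, hr'⟩ := Submodule.exists_sub_one_mem_and_smul_eq_zero_of_fg_of_le_smul
    (Ideal.span {l}) (M.map G.mkQ) hfg (by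
      rw [hM, Submodule.map_span, Submodule.span_le]
      rintro _ ⟨_, ⟨V, hV, rfl⟩, rfl⟩
      obtain ⟨x, hx, y, hy, e⟩ := reduce hΓ h1Γ hΓi hq hb hΛ w _ V le_rfl hV
      rw [e, map_add, map_smul]
      have : G.mkQ x = 0 := (Submodule.Quotient.mk_eq_zero G).2 hx
      rw [this, zero_add, ← Submodule.map_span]
      exact Submodule.smul_mem_smul (Ideal.mem_span_singleton_self l)
        (Submodule.mem_map_of_mem hy))
  refine ⟨r, ?_, fun V hV => ?_⟩
  · rintro rfl
    rw [Ideal.mem_span_singleton] at hr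
    apply hl
    apply isUnit_of_dvd_one
    simpa using hr
  · have := hr' _ (Submodule.mem_map_of_mem (Submodule.subset_span ⟨V, hV, rfl⟩))
    rw [← map_smul] at this
    exact (Submodule.Quotient.mk_eq_zero G).1 this
end abs

section conc
open scoped WithZero
open WithZero (exp log)

lemma nonarch (R : Type*) [Ring R] (Γ₀ : Type*) [LinearOrderedCommGroupWithZero Γ₀]
    [_i : Valued R Γ₀] : NonarchimedeanRing R :=
  (Valued.toUniformSpace_eq R Γ₀).symm ▸ (Valued.v (R := R)).subgroups_basis.nonarchimedean

lemma nhds_zero_exp (K : Type*) [Field K] {s : Set (LaurentSeries K)} (hs : s ∈ 𝓝 0) :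
    ∃ m : ℕ, ∀ x : LaurentSeries K, Valued.v x ≤ exp (-(m : ℤ)) → x ∈ s := by
  obtain ⟨γ, hγ⟩ := Valued.mem_nhds_zero.1 hs
  have h0 : MonoidWithZeroHom.ValueGroup₀.embedding γ.1 ≠ 0 := by simp
  refine ⟨(-(log (MonoidWithZeroHom.ValueGroup₀.embedding γ.1)) + 1).toNat, fun x hx => hγ ?_⟩
  show Valued.v.restrict x < γ.1
  rw [Valuation.restrict_lt_iff_lt_embedding]
  refine hx.trans_lt ?_
  rw [← WithZero.lt_log_iff_exp_lt h0]
  omega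

lemma summ (K : Type*) [Field K] {α : Type*} (f : α → LaurentSeries K) (g : α → ℕ)
    (h : ∀ a, Valued.v (f a) ≤ exp (-(g a : ℤ))) (hg : ∀ m, {a | g a ≤ m}.Finite) :
    Summable f := by
  have := nonarch (LaurentSeries K) ℤᵐ⁰
  apply NonarchimedeanAddGroup.summable_of_tendsto_cofinite_zero
  intro s hs
  obtain ⟨m, hm⟩ := nhds_zero_exp K hs
  rw [Filter.mem_map, Filter.mem_cofinite]
  refine (hg m).subset fun a ha => ?_
  by_contra hlt
  apply ha
  apply hm
  refine (h a).trans ?_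
  rw [WithZero.exp_le_exp]
  simp at hlt
  omega

lemma exp_sum' {ι : Type*} (t : Finset ι) (g : ι → ℤ) :
    (exp (∑ i ∈ t, g i) : ℤᵐ⁰) = ∏ i ∈ t, exp (g i) := by
  induction t using Finset.induction_on with
  | empty => simp
  | insert a t ha ih => rw [Finset.sum_insert ha, Finset.prod_insert ha, WithZero.exp_add, ih]

/-- bounded strictly decreasing tuples -/
def B (n d : ℕ) : Finset (Fin n → ℕ) :=
  (Fintype.piFinset fun _ => Finset.range d).filter StrictAnti

lemma mem_B {n d : ℕ} {f : Fin n → ℕ} : f ∈ B n d ↔ (∀ i, f i < d) ∧ StrictAnti f := by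
  simp [B]

lemma mem_B_succ {n d : ℕ} {f : Fin (n + 1) → ℕ} :
    f ∈ B (n + 1) d ↔ f 0 < d ∧ Fin.tail f ∈ B n (f 0) := by
  simp only [mem_B, Fin.tail]
  constructor
  · rintro ⟨h1, h2⟩
    exact ⟨h1 0, fun i => h2 (Fin.succ_pos i), fun i j hij => h2 (Fin.succ_lt_succ_iff.2 hij)⟩
  · rintro ⟨h1, h2, h3⟩
    refine ⟨fun i => ?_, fun i j hij => ?_⟩
    · refine Fin.cases h1 (fun i => (h2 i).trans h1) i
    · induction i using Fin.cases with
      | zero =>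
        induction j using Fin.cases with
        | zero => exact absurd hij (lt_irrefl _)
        | succ j => exact h2 j
      | succ i =>
        induction j using Fin.cases with
        | zero => exact absurd hij (Fin.not_lt_zero _)
        | succ j => exact h3 (Fin.succ_lt_succ_iff.1 hij)

lemma sum_B {L : Type} [Field L] (b : ℕ → L) (n : ℕ) : ∀ (a : Fin n → ℕ × L) (d : ℕ),
    ∑ f ∈ B n d, ∏ i, ((a i).2 ^ f i * b (f i) ^ (a i).1) = S b (List.ofFn a) d := by
  induction n with
  | zero =>
    intro a d
    have : B 0 d = {Fin.elim0} := by
      ext f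
      simp only [mem_B, Finset.mem_singleton]
      exact ⟨fun _ => Subsingleton.elim _ _, fun _ => ⟨fun i => i.elim0, fun i => i.elim0⟩⟩
    simp [this, S]
  | succ n ih =>
    intro a d
    rw [List.ofFn_succ]
    simp only [S, D]
    have : ∀ j, a 0 = a 0 → (a 0).2 ^ j * b j ^ (a 0).1 * S b (List.ofFn fun i => a i.succ) j =
        ∑ f ∈ B n j, (a 0).2 ^ j * b j ^ (a 0).1 *
          ∏ i, ((a i.succ).2 ^ f i * b (f i) ^ (a i.succ).1) := by
      intro j _
      rw [← ih (fun i => a i.succ) j, Finset.mul_sum]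
    simp only [this, Finset.sum_sigma']
    refine Finset.sum_bij' (fun f _ => (⟨f 0, Fin.tail f⟩ : (_ : ℕ) × (Fin n → ℕ)))
      (fun p _ => (Fin.cons p.1 p.2 : Fin (n + 1) → ℕ)) ?_ ?_ ?_ ?_ ?_
    · intro f hf
      rw [mem_B_succ] at hf
      simp [hf]
    · rintro ⟨j, f⟩ hp
      rw [mem_B_succ]
      simpa using hp
    · intro f _; simp
    · rintro ⟨j, f⟩ _; simp
    · intro f _
      rw [Fin.prod_univ_succ]; rfl

variable (Fq : Type) [Field Fq] [Fintype Fq]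

lemma two_le_q : 2 ≤ qc Fq := Fintype.one_lt_card

lemma v_theta : Valued.v (theta Fq) = (exp 1 : ℤᵐ⁰) := by
  simp [theta, LaurentSeries.valuation_single_zpow]

lemma v_diff {i : ℕ} (hi : 1 ≤ i) :
    Valued.v (theta Fq - theta Fq ^ qc Fq ^ i) = (exp 1 : ℤᵐ⁰) ^ qc Fq ^ i := by
  rw [Valuation.map_sub_eq_of_lt_right, map_pow, v_theta]
  rw [map_pow, v_theta]
  have h1 : (1 : ℤᵐ⁰) < exp 1 := by
    rw [← WithZero.exp_zero, WithZero.exp_lt_exp]; norm_num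
  exact lt_self_pow₀ h1 (Nat.one_lt_pow (by omega) (two_le_q Fq))

lemma v_ell (d : ℕ) : (exp (d : ℤ) : ℤᵐ⁰) ≤ Valued.v (ell Fq d) := by
  have h1 : (1 : ℤᵐ⁰) ≤ exp 1 := by
    rw [← WithZero.exp_zero, WithZero.exp_le_exp]; norm_num
  induction d with
  | zero => simp [ell]
  | succ d ih =>
    rw [ell, Finset.prod_Icc_succ_top (by omega), map_mul]
    push_cast
    rw [WithZero.exp_add, v_diff Fq (by omega)]
    refine mul_le_mul' ih ?_
    exact le_self_pow₀ h1 (pow_ne_zero _ (by have := two_le_q Fq; omega))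

lemma ell_ne (d : ℕ) : ell Fq d ≠ 0 := by
  intro h
  have := v_ell Fq d
  rw [h, map_zero] at this
  simp at this

lemma ell_succ (d : ℕ) :
    ell Fq (d + 1) = ell Fq d * (theta Fq - theta Fq ^ qc Fq ^ (d + 1)) := by
  rw [ell, Finset.prod_Icc_succ_top (by omega)]; rfl

lemma ell_zero : ell Fq 0 = 1 := by simp [ell]
lemma ell_one : ell Fq 1 = theta Fq - theta Fq ^ qc Fq := by simp [ell]

lemma frob (x y : Kinf Fq) : (x - y) ^ qc Fq = x ^ qc Fq - y ^ qc Fq := by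
  obtain ⟨p, hp⟩ := CharP.exists Fq
  obtain ⟨n, hpp, hc⟩ := FiniteField.card Fq p
  have : Fact p.Prime := ⟨hpp⟩
  have : CharP (Kinf Fq) p := charP_of_injective_ringHom (f := cst Fq) (cst Fq).injective p
  rw [qc, hc]
  exact sub_pow_char_pow x y _

lemma sum_ell (d : ℕ) : ∑ j ∈ Finset.range (d + 1), (ell Fq j)⁻¹ ^ (qc Fq - 1) =
    ell Fq (d + 1) / (ell Fq 1 * ell Fq d ^ qc Fq) := by
  induction d with
  | zero => simp [ell_zero, ell_ne]
  | succ d ih =>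
    rw [Finset.sum_range_succ, ih]
    have h0 := ell_ne Fq d
    have h1 := ell_ne Fq 1
    have h2 := ell_ne Fq (d + 1)
    have hf : ell Fq (d + 1) ^ qc Fq =
        ell Fq d ^ qc Fq * (theta Fq ^ qc Fq - theta Fq ^ qc Fq ^ (d + 2)) := by
      rw [ell_succ, mul_pow, frob, ← pow_mul, ← pow_succ]
    have hq : (ell Fq (d + 1))⁻¹ ^ (qc Fq - 1) = ell Fq (d + 1) / ell Fq (d + 1) ^ qc Fq := by
      rw [inv_pow, eq_div_iff (pow_ne_zero _ h2), inv_mul_eq_iff_eq_mul₀ (pow_ne_zero _ h2),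
        ← pow_succ]
      congr 1
      have := two_le_q Fq; omega
    rw [hq, ell_succ Fq (d + 1)]
    rw [div_add_div _ _ (mul_ne_zero h1 (pow_ne_zero _ h0)) (pow_ne_zero _ h2),
      div_eq_div_iff (mul_ne_zero (mul_ne_zero h1 (pow_ne_zero _ h0)) (pow_ne_zero _ h2))
      (mul_ne_zero h1 (pow_ne_zero _ h2))]
    rw [hf, ell_one]
    ring

lemma rel (d : ℕ) : (ell Fq d)⁻¹ ^ qc Fq = ell Fq 1 * (ell Fq (d + 1))⁻¹ *
    ∑ j ∈ Finset.range (d + 1), (ell Fq j)⁻¹ ^ (qc Fq - 1) := by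
  rw [sum_ell]
  have h0 := ell_ne Fq d
  have h1 := ell_ne Fq 1
  have h2 := ell_ne Fq (d + 1)
  rw [inv_pow]
  field_simp

/-- elements whose coefficients at positive exponents vanish -/
def polySub : Subring (Kinf Fq) where
  carrier := {x | ∀ n : ℤ, 0 < n → x.coeff n = 0}
  mul_mem' := by
    intro x y hx hy n hn
    rw [HahnSeries.coeff_mul]
    refine Finset.sum_eq_zero fun ij hij => ?_
    have := (Finset.mem_antidiagonal.1 hij).2.2
    by_cases h : 0 < ij.1
    · rw [hx _ h, zero_mul]
    · rw [hy ij.2 (by omega), mul_zero]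
  one_mem' := by
    intro n hn
    rw [HahnSeries.coeff_one, if_neg hn.ne']
  add_mem' := by
    intro x y hx hy n hn
    rw [HahnSeries.coeff_add, hx n hn, hy n hn, add_zero]
  zero_mem' := by intro n _; rfl
  neg_mem' := by
    intro x hx n hn
    rw [HahnSeries.coeff_neg, hx n hn, neg_zero]

lemma AN_le (N : ℕ) : AN Fq N ≤ polySub Fq := by
  rw [AN, Subring.closure_le]
  rintro x (⟨c, _, rfl⟩ | rfl)
  · intro n hn
    simp only [cst, HahnSeries.C_apply]
    exact HahnSeries.coeff_single_of_ne hn.ne'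
  · intro n hn
    exact HahnSeries.coeff_single_of_ne (by omega)

lemma theta_mem (N : ℕ) : theta Fq ∈ AN Fq N := Subring.subset_closure (Or.inr rfl)

lemma ell_one_mem (N : ℕ) : ell Fq 1 ∈ AN Fq N := by
  rw [ell_one]
  exact sub_mem (theta_mem Fq N) (pow_mem (theta_mem Fq N) _)

lemma not_unit (N : ℕ) : ¬ IsUnit (⟨ell Fq 1, ell_one_mem Fq N⟩ : AN Fq N) := by
  intro h
  obtain ⟨a, ha⟩ := h.exists_right_inv
  have ha' : ell Fq 1 * (a : Kinf Fq) = 1 := congrArg Subtype.val ha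
  have hv := v_ell Fq 1
  have hva : Valued.v (a : Kinf Fq) ≤ (exp (-1 : ℤ) : ℤᵐ⁰) := by
    have := congrArg (Valued.v (R := Kinf Fq)) ha'
    rw [map_mul, map_one] at this
    rw [eq_inv_of_mul_eq_one_right this, WithZero.exp_neg]
    exact inv_anti₀ WithZero.exp_pos (by simpa using hv)
  rw [LaurentSeries.valuation_le_iff_coeff_lt_eq_zero] at hva
  have : (a : Kinf Fq) = 0 := by
    ext n
    by_cases hn : n < 1
    · exact hva n hn
    · exact AN_le Fq N a.2 n (by omega)
  rw [this, mul_zero] at ha'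
  exact zero_ne_one ha'

/-- the list of an array -/
def lst (A : PArr (Fb Fq)) : List (ℕ × Kinf Fq) :=
  List.ofFn fun i => (A.s i, cst Fq (A.eps i))

/-- roots of unity in `Kinf` -/
def Gam (N : ℕ) : Set (Kinf Fq) := cst Fq '' {x | x ^ N = 1}

lemma v_root {N : ℕ} (hN : 0 < N) {x : Fb Fq} (hx : x ^ N = 1) :
    Valued.v (cst Fq x) = (1 : ℤᵐ⁰) := by
  have : (Valued.v (cst Fq x) : ℤᵐ⁰) ^ N = 1 := by rw [← map_pow, ← map_pow, hx, map_one, map_one]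
  exact (pow_eq_one_iff.1 this).resolve_right hN.ne'

lemma tendsto_Li {N : ℕ} (hN : 0 < N) (A : PArr (Fb Fq)) (hA : A.Positive N) :
    Tendsto (S (fun j => (ell Fq j)⁻¹) (lst Fq A)) atTop (𝓝 (Li Fq A)) := by
  have hs : Summable fun d : {f : Fin A.depth → ℕ // StrictAnti f} =>
      ∏ i, cst Fq (A.eps i ^ d.1 i) / ell Fq (d.1 i) ^ A.s i := by
    refine summ (Fb Fq) _ (fun f => ∑ i, f.1 i) ?_ ?_
    · intro f
      rw [map_prod]
      push_cast
      rw [← Finset.sum_neg_distrib, exp_sum']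
      refine Finset.prod_le_prod' fun i _ => ?_
      rw [map_div₀, map_pow, map_pow, map_pow, v_root Fq hN (hA.2 i), one_pow, one_div,
        WithZero.exp_neg]
      refine inv_anti₀ WithZero.exp_pos ((v_ell Fq _).trans (le_self_pow₀ ?_ (hA.1 i).ne'))
      refine le_trans ?_ (v_ell Fq _)
      rw [← WithZero.exp_zero, WithZero.exp_le_exp]; positivity
    · intro m
      refine Set.Finite.of_injOn (f := Subtype.val) (t := ((Fintype.piFinset
        fun _ : Fin A.depth => Finset.range (m + 1) : Finset _) : Set (Fin A.depth → ℕ)))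
        ?_ Subtype.val_injective.injOn (Finset.finite_toSet _)
      intro f hf
      simp only [Finset.mem_coe, Fintype.mem_piFinset, Finset.mem_range]
      intro i
      have h1 : f.1 i ≤ ∑ i, f.1 i :=
        Finset.single_le_sum (f := f.1) (fun _ _ => Nat.zero_le _) (Finset.mem_univ i)
      have h2 : ∑ i, f.1 i ≤ m := hf
      omega
  have hB : Tendsto (fun d => (B A.depth d).subtype StrictAnti) atTop atTop := by
    refine Filter.tendsto_atTop_finset_of_monotone ?_ ?_
    · intro d e hde f hf
      rw [Finset.mem_subtype, mem_B] at hf ⊢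
      exact ⟨fun i => (hf.1 i).trans_le hde, hf.2⟩
    · intro f
      refine ⟨∑ i, f.1 i + 1, ?_⟩
      rw [Finset.mem_subtype, mem_B]
      exact ⟨fun i => Nat.lt_succ_of_le
        (Finset.single_le_sum (f := f.1) (fun _ _ => Nat.zero_le _) (Finset.mem_univ i)), f.2⟩
  have ht := hs.hasSum.comp hB
  refine ht.congr fun d => ?_
  rw [lst, ← sum_B]
  simp only [Function.comp]
  rw [Finset.sum_subtype_of_mem (p := StrictAnti)
    (f := fun f : Fin A.depth → ℕ => ∏ i, cst Fq (A.eps i ^ f i) / ell Fq (f i) ^ A.s i)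
    (fun f hf => (mem_B.1 hf).2)]
  refine Finset.sum_congr rfl fun f _ => Finset.prod_congr rfl fun i _ => ?_
  rw [map_pow, inv_pow, div_eq_mul_inv]

lemma Pos_lst {N w : ℕ} {A : PArr (Fb Fq)} (hA : A.Positive N) (hw : A.wt = w) :
    Pos (Gam Fq N) w (lst Fq A) := by
  refine ⟨?_, ?_⟩
  · intro a ha
    obtain ⟨i, rfl⟩ := (List.mem_ofFn' _ _).1 ha
    exact ⟨hA.1 i, _, hA.2 i, rfl⟩
  · rw [lst, List.map_ofFn, List.sum_ofFn, ← hw]; rfl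

lemma exists_lst {N w : ℕ} {V : List (ℕ × Kinf Fq)} (h : Pos (Gam Fq N) w V) :
    ∃ A : PArr (Fb Fq), A.Positive N ∧ A.wt = w ∧ lst Fq A = V := by
  have : ∀ i : Fin V.length, ∃ e : Fb Fq, e ^ N = 1 ∧ cst Fq e = (V.get i).2 := fun i => by
    obtain ⟨e, he, he'⟩ := (h.1 _ (List.get_mem V i)).2
    exact ⟨e, he, he'⟩
  choose e he he' using this
  have hl : lst Fq ⟨V.length, fun i => (V.get i).1, e⟩ = V := by
    simp only [lst, he']
    exact List.ofFn_get V
  refine ⟨⟨V.length, fun i => (V.get i).1, e⟩, ⟨fun i => (h.1 _ (List.get_mem V i)).1, he⟩, ?_, hl⟩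
  rw [← h.2]
  conv_rhs => rw [← hl, lst, List.map_ofFn, List.sum_ofFn]
  rfl

lemma AN_le_KNf (N : ℕ) {x : Kinf Fq} (hx : x ∈ AN Fq N) : x ∈ KNf Fq N := by
  have : AN Fq N ≤ (KNf Fq N).toSubring := by
    rw [AN, Subring.closure_le]
    exact Subfield.subset_closure
  exact this hx

end conc
end Aux

set_option synthInstance.maxHeartbeats 1000000

/-- **Strong Brown–Deligne theorem for CMPL's** (Theorem `strong BD CMPL`): the set
`{Li(𝛆;𝔰) : 𝔰 ∈ S_w, 𝛆 ∈ Γ_N^{depth 𝔰}}` spans the `K_N`-vector space `CL_{N,w}`. -/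
theorem strong_brown_deligne_CMPL
    (Fq : Type) [Field Fq] [Fintype Fq] (N w : ℕ) (hN : 0 < N) (hw : 0 < w) :
    Submodule.span (KNf Fq N) (Set.range fun A : SwIdx Fq N w => Li Fq A.1)
      = CL Fq N w := by
  apply le_antisymm
  · rw [Submodule.span_le]
    rintro _ ⟨A, rfl⟩
    exact Submodule.subset_span ⟨A.1, A.2.1, A.2.2.2.1, rfl⟩
  · rw [CL, Submodule.span_le]
    rintro _ ⟨A, hA, hAw, rfl⟩
    let Λ : List (ℕ × Kinf Fq) → Kinf Fq := fun V =>
      Filter.atTop.limUnder (Aux.S (fun j => (ell Fq j)⁻¹) V)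
    have hΛA : ∀ A : PArr (Fb Fq), A.Positive N → Λ (Aux.lst Fq A) = Li Fq A := fun A hA =>
      (Aux.tendsto_Li Fq hN A hA).limUnder_eq
    obtain ⟨r, hr, hmem⟩ := Aux.main_abs (b := fun j => (ell Fq j)⁻¹) (R := AN Fq N)
      (Γ := Aux.Gam Fq N) (Λ := Λ) (l := ⟨ell Fq 1, Aux.ell_one_mem Fq N⟩) (q := qc Fq)
      (by
        rintro _ ⟨x, hx, rfl⟩ _ ⟨y, hy, rfl⟩
        refine ⟨x * y, ?_, map_mul _ _ _⟩
        have hx : x ^ N = 1 := hx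
        have hy : y ^ N = 1 := hy
        show (x * y) ^ N = 1
        rw [mul_pow, hx, hy, one_mul])
      ⟨1, one_pow N, map_one _⟩
      (by
        rintro _ ⟨x, hx, rfl⟩
        have hx : x ^ N = 1 := hx
        have hx0 : x ≠ 0 := by
          rintro rfl
          rw [zero_pow hN.ne'] at hx
          exact zero_ne_one hx
        refine ⟨(map_ne_zero _).2 hx0, Subring.subset_closure (Or.inl ⟨x⁻¹, ?_, map_inv₀ _ _⟩)⟩
        exact inv_mem (Subfield.subset_closure (Or.inr hx)))
      (Aux.two_le_q Fq) (Aux.rel Fq)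
      (by
        intro w V hV
        obtain ⟨A, hA, -, rfl⟩ := Aux.exists_lst Fq hV
        rw [hΛA A hA]
        exact Aux.tendsto_Li Fq hN A hA)
      (by
        refine Set.Finite.image _ ?_
        refine ((Polynomial.nthRootsFinset N (1 : Fb Fq)).finite_toSet).subset fun x hx => ?_
        exact (Polynomial.mem_nthRootsFinset hN _).2 hx)
      (Aux.not_unit Fq N) w
    have h1 := hmem _ (Aux.Pos_lst Fq hA hAw)
    rw [hΛA A hA] at h1
    have key : ∀ x ∈ Submodule.span (AN Fq N)
        (Λ '' {V | Aux.Pos (Aux.Gam Fq N) w V ∧ ∀ a ∈ V, ¬ qc Fq ∣ a.1}),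
        x ∈ Submodule.span (KNf Fq N) (Set.range fun A : SwIdx Fq N w => Li Fq A.1) := by
      intro x hx
      induction hx using Submodule.span_induction with
      | mem x hx =>
        obtain ⟨V, ⟨hV, hVq⟩, rfl⟩ := hx
        obtain ⟨A, hA, hAw, rfl⟩ := Aux.exists_lst Fq hV
        rw [hΛA A hA]
        refine Submodule.subset_span ⟨⟨A, hA, ?_, hAw, ?_⟩, rfl⟩
        · rcases Nat.eq_zero_or_pos A.depth with h0 | h0
          · exfalso
            obtain ⟨n, s, e⟩ := A
            simp only at h0
            subst h0
            simp [PArr.wt] at hAw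
            omega
          · exact h0
        · intro i
          exact hVq _ ((List.mem_ofFn' _ _).2 ⟨i, rfl⟩)
      | zero => exact Submodule.zero_mem _
      | add x y _ _ hx hy => exact Submodule.add_mem _ hx hy
      | smul c x _ hx =>
        exact Submodule.smul_mem _ (⟨c.1, Aux.AN_le_KNf Fq N c.2⟩ : KNf Fq N) hx
    have h2 := Submodule.smul_mem _ (⟨r.1, Aux.AN_le_KNf Fq N r.2⟩ : KNf Fq N)⁻¹ (key _ h1)
    have hr' : (r : Kinf Fq) ≠ 0 := fun h => hr (Subtype.ext h)
    have h3 : (⟨r.1, Aux.AN_le_KNf Fq N r.2⟩ : KNf Fq N)⁻¹ • (r • Li Fq A) = Li Fq A := by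
      show (r.1)⁻¹ * (r.1 * Li Fq A) = Li Fq A
      rw [inv_mul_cancel_left₀ hr']
    rw [h3] at h2
    exact h2

end ZHPC
end
end
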